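/- Suppose f is a function from the family of all finite simple graphs to the natural numbers satisfying: (1) reg(I(G)) ≤ f(G) for every graph G, and (2) for every graph G with at least one edge there is a vertex w with f(G − w) ≤ f(G) and f(G − N_G[w]) ≤ max{f(G) − 1, 2}. Then for every graph G and every integer s ≥ 1, reg(I(G)^s) ≤ 2s + f(G) − 2. -/

import Mathlib

open SimpleGraph

namespace Paper

/-- The complete graph on two vertices, `K₂`. -/
def k2 : SimpleGraph (Fin 2) := ⊤

/-- The 5-cycle `C₅`. -/
def cycle5 : SimpleGraph (ZMod 5) := SimpleGraph.fromRel (fun a b => b = a + 1)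

/-- A graph is chordal if it has no induced cycle of length at least four. -/
def IsChordal {V : Type*} (G : SimpleGraph V) : Prop :=
  ∀ n : ℕ, 4 ≤ n → IsEmpty (SimpleGraph.cycleGraph n ↪g G)

/-- A graph is co-chordal if its complement is chordal. -/
def IsCochordal {V : Type*} (G : SimpleGraph V) : Prop := IsChordal Gᶜ

/-- The co-chordal cover number: the minimum number of co-chordal subgraphs of `G`
needed to cover all edges of `G`. -/
noncomputable def cochord {V : Type*} (G : SimpleGraph V) : ℕ :=
  sInf { t | ∃ f : Fin t → SimpleGraph V,
    (∀ i, f i ≤ G ∧ IsCochordal (f i)) ∧ ∀ ⦃u v : V⦄, G.Adj u v → ∃ i, (f i).Adj u v }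

/-- The closed neighborhood `N_G[w]`. -/
def closedNbhd {V : Type*} (G : SimpleGraph V) (w : V) : Set V :=
  insert w (G.neighborSet w)

/-- The graph `G - N_G[w]`: the induced subgraph on the complement of the closed
neighborhood of `w`. -/
def delClosedNbhd {V : Type*} (G : SimpleGraph V) (w : V) :
    SimpleGraph ((closedNbhd G w)ᶜ : Set V) := G.induce _

/-- The edge ideal of a graph `G`, in the polynomial ring over `K` with variables
indexed by the vertices of `G`. -/
noncomputable def edgeIdeal (K : Type) [Field K] {V : Type} (G : SimpleGraph V) :
    Ideal (MvPolynomial V K) :=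
  Ideal.span { m | ∃ u v : V, G.Adj u v ∧ m = MvPolynomial.X u * MvPolynomial.X v }

/-- `HasResolutionDegreeBound K I r` says that the ideal `I` admits a graded free
resolution `⋯ → F₁ → F₀ → I → 0`, where `Fᵢ = ⊕_k S(-d i k)` is a graded free module
whose generators sit in degrees `d i k ≤ i + r`.  The maps are required to be graded
(degree-preserving) and the sequence exact.  By the standard characterization via the
minimal graded free resolution, the Castelnuovo–Mumford regularity of `I` is the least
`r` for which such a resolution exists. -/
def HasResolutionDegreeBound (K : Type) [Field K] {V : Type}
    (I : Ideal (MvPolynomial V K)) (r : ℕ) : Prop :=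
  ∃ (m : ℕ → ℕ) (d : (i : ℕ) → Fin (m i) → ℕ)
    (f : (i : ℕ) → ((Fin (m (i + 1)) → MvPolynomial V K) →ₗ[MvPolynomial V K]
        (Fin (m i) → MvPolynomial V K)))
    (ε : (Fin (m 0) → MvPolynomial V K) →ₗ[MvPolynomial V K] MvPolynomial V K),
    -- the augmentation map is graded: the image of the `k`-th basis vector is
    -- homogeneous of degree `d 0 k`
    (∀ k, MvPolynomial.IsHomogeneous (ε (Pi.single k 1)) (d 0 k)) ∧
    -- the differentials are graded maps of degree zero
    (∀ i k l, MvPolynomial.IsHomogeneous (f i (Pi.single k 1) l) (d (i + 1) k - d i l) ∧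
        (d (i + 1) k < d i l → f i (Pi.single k 1) l = 0)) ∧
    -- exactness: `F₀` surjects onto `I`, and the complex is exact
    LinearMap.range ε = I ∧
    LinearMap.range (f 0) = LinearMap.ker ε ∧
    (∀ i, LinearMap.range (f (i + 1)) = LinearMap.ker (f i)) ∧
    -- the degree bound on the twists
    (∀ i k, d i k ≤ i + r)

/-- The Castelnuovo–Mumford regularity of an ideal in a polynomial ring:
the least `r` such that `I` has a graded free resolution whose `i`-th free module is
generated in degrees `≤ i + r`. -/
noncomputable def reg (K : Type) [Field K] {V : Type} (I : Ideal (MvPolynomial V K)) : ℕ :=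
  sInf { r | HasResolutionDegreeBound K I r }

section Graded

/-- The family `ℳ` shifted by `δ`, that is, the grading of `M(-δ)`. -/
def shiftGr {M : Type} [AddCommGroup M] (ℳ : ℕ → AddSubgroup M) (δ e : ℕ) : AddSubgroup M where
  carrier := {a | (δ ≤ e → a ∈ ℳ (e - δ)) ∧ (e < δ → a = 0)}
  zero_mem' := ⟨fun _ => zero_mem _, fun _ => rfl⟩
  add_mem' := fun ha hb => ⟨fun h => add_mem (ha.1 h) (hb.1 h), fun h => by
    rw [ha.2 h, hb.2 h, add_zero]⟩
  neg_mem' := fun ha => ⟨fun h => neg_mem (ha.1 h), fun h => by rw [ha.2 h, neg_zero]⟩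

theorem mem_shiftGr_add {M : Type} [AddCommGroup M] {ℳ : ℕ → AddSubgroup M} {δ e : ℕ} {a : M} :
    a ∈ shiftGr ℳ δ (e + δ) ↔ a ∈ ℳ e :=
  ⟨fun h => by simpa using h.1 (Nat.le_add_left _ _),
    fun h => ⟨fun _ => by simpa using h, fun h' => by omega⟩⟩

theorem eq_zero_of_mem_shiftGr {M : Type} [AddCommGroup M] {ℳ : ℕ → AddSubgroup M} {δ e : ℕ}
    (h : e < δ) {a : M} (ha : a ∈ shiftGr ℳ δ e) : a = 0 := ha.2 h

/-- The degree `e` part of the free module `⨁ S(-d l)`. -/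
def freeGr {S : Type} [CommRing S] (𝒮 : ℕ → AddSubgroup S) {ι : Type} (d : ι → ℕ) (e : ℕ) :
    AddSubgroup (ι → S) where
  carrier := {x | ∀ l, x l ∈ shiftGr 𝒮 (d l) e}
  zero_mem' := fun _ => zero_mem _
  add_mem' := fun ha hb l => add_mem (ha l) (hb l)
  neg_mem' := fun ha l => neg_mem (ha l)

/-- The induced grading on a submodule. -/
def subGr {S M : Type} [CommRing S] [AddCommGroup M] [Module S M] (ℳ : ℕ → AddSubgroup M)
    (N : Submodule S M) (e : ℕ) : AddSubgroup N := (ℳ e).comap N.subtype.toAddMonoidHom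

theorem mem_subGr {S M : Type} [CommRing S] [AddCommGroup M] [Module S M]
    {ℳ : ℕ → AddSubgroup M} {N : Submodule S M} {e : ℕ} {a : N} :
    a ∈ subGr ℳ N e ↔ (a : M) ∈ ℳ e := Iff.rfl

/-- Compatibility of the family `ℳ` with scalar multiplication. -/
def GradedSMulFamily {S M : Type} [CommRing S] [AddCommGroup M] [Module S M]
    (𝒮 : ℕ → AddSubgroup S) (ℳ : ℕ → AddSubgroup M) : Prop :=
  ∀ ⦃i j : ℕ⦄ ⦃s : S⦄ ⦃a : M⦄, s ∈ 𝒮 i → a ∈ ℳ j → s • a ∈ ℳ (i + j)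

/-- `HasFiniteRes 𝒮 n M ℳ r`: the graded module `M` has a graded free resolution of length less
than `n` whose `i`-th module is generated in degrees at most `i + r`. -/
def HasFiniteRes {S : Type} [CommRing S] (𝒮 : ℕ → AddSubgroup S) :
    ℕ → ∀ (M : Type) [AddCommGroup M] [Module S M], (ℕ → AddSubgroup M) → ℕ → Prop
  | 0, M, _, _, _, _ => Subsingleton M
  | n + 1, M, _, _, ℳ, r => ∃ (ι : Type) (_ : Fintype ι) (d : ι → ℕ) (π : (ι → S) →ₗ[S] M),
      (∀ l, d l ≤ r) ∧ Function.Surjective π ∧ (∀ e, ∀ x ∈ freeGr 𝒮 d e, π x ∈ ℳ e) ∧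
      (∀ e, ∀ a ∈ ℳ e, ∃ x ∈ freeGr 𝒮 d e, π x = a) ∧
      HasFiniteRes 𝒮 n (LinearMap.ker π) (subGr (freeGr 𝒮 d) (LinearMap.ker π)) (r + 1)

variable {S : Type} [CommRing S] {𝒮 : ℕ → AddSubgroup S}

theorem GradedSMulFamily.sub {M : Type} [AddCommGroup M] [Module S M] {ℳ : ℕ → AddSubgroup M}
    (h : GradedSMulFamily 𝒮 ℳ) (N : Submodule S M) : GradedSMulFamily 𝒮 (subGr ℳ N) :=
  fun _ _ _ _ hs ha => h hs ha

theorem GradedSMulFamily.shift {M : Type} [AddCommGroup M] [Module S M] {ℳ : ℕ → AddSubgroup M}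
    (h : GradedSMulFamily 𝒮 ℳ) (δ : ℕ) : GradedSMulFamily 𝒮 (shiftGr ℳ δ) := by
  intro i j s a hs ha
  rcases le_or_gt δ j with hj | hj
  · obtain ⟨j, rfl⟩ := Nat.exists_eq_add_of_le' hj
    rw [← add_assoc, mem_shiftGr_add]
    exact h hs (mem_shiftGr_add.1 ha)
  · rw [ha.2 hj, smul_zero]
    exact zero_mem _

theorem GradedSMulFamily.prod {M N : Type} [AddCommGroup M] [Module S M] [AddCommGroup N]
    [Module S N] {ℳ : ℕ → AddSubgroup M} {𝒩 : ℕ → AddSubgroup N}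
    (h : GradedSMulFamily 𝒮 ℳ) (h' : GradedSMulFamily 𝒮 𝒩) :
    GradedSMulFamily 𝒮 (fun e => (ℳ e).prod (𝒩 e)) :=
  fun _ _ _ _ hs ha => ⟨h hs ha.1, h' hs ha.2⟩

theorem gradedSMulFamily_self [SetLike.GradedMonoid 𝒮] : GradedSMulFamily 𝒮 𝒮 :=
  fun _ _ _ _ hs ha => SetLike.mul_mem_graded hs ha

theorem gradedSMulFamily_free [SetLike.GradedMonoid 𝒮] {ι : Type} (d : ι → ℕ) : GradedSMulFamily 𝒮
    (freeGr 𝒮 d) :=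
  fun _ _ _ _ hs ha l => gradedSMulFamily_self.shift (d l) hs (ha l)

theorem single_mem_freeGr [SetLike.GradedMonoid 𝒮] {ι : Type} [DecidableEq ι] (d : ι → ℕ) (l : ι) :
    Pi.single l (1 : S) ∈ freeGr 𝒮 d (d l) := by
  intro k
  rcases eq_or_ne k l with rfl | h
  · refine ⟨fun _ => ?_, fun h => by omega⟩
    simpa using SetLike.one_mem_graded 𝒮
  · rw [Pi.single_eq_of_ne h]
    exact zero_mem _

theorem HasFiniteRes.of_subsingleton (n : ℕ) {M : Type} [AddCommGroup M] [Module S M]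
    {ℳ : ℕ → AddSubgroup M} {r : ℕ} (h : Subsingleton M) : HasFiniteRes 𝒮 n M ℳ r := by
  induction n generalizing M r with
  | zero => exact h
  | succ n ih =>
    refine ⟨Empty, inferInstance, fun _ => 0, 0, fun l => l.elim, fun a =>
      ⟨0, Subsingleton.elim _ _⟩,
      fun e x _ => zero_mem _, fun e a _ => ⟨0, zero_mem _, Subsingleton.elim _ _⟩, ih ?_⟩
    exact inferInstance

theorem HasFiniteRes.succ {n : ℕ} {M : Type} [AddCommGroup M] [Module S M]
    {ℳ : ℕ → AddSubgroup M} {r : ℕ} (h : HasFiniteRes 𝒮 n M ℳ r) :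
    HasFiniteRes 𝒮 (n + 1) M ℳ r := by
  induction n generalizing M r with
  | zero => exact .of_subsingleton _ h
  | succ n ih =>
    obtain ⟨ι, hι, d, π, h1, h2, h3, h4, h5⟩ := h
    exact ⟨ι, hι, d, π, h1, h2, h3, h4, ih h5⟩

theorem HasFiniteRes.mono {n n' : ℕ} {M : Type} [AddCommGroup M] [Module S M]
    {ℳ : ℕ → AddSubgroup M} {r r' : ℕ} (h : HasFiniteRes 𝒮 n M ℳ r) (hn : n ≤ n') (hr : r ≤ r') :
    HasFiniteRes 𝒮 n' M ℳ r' := by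
  have h' : HasFiniteRes 𝒮 n M ℳ r' := by
    clear hn
    induction n generalizing M r r' with
    | zero => exact h
    | succ n ih =>
      obtain ⟨ι, hι, d, π, h1, h2, h3, h4, h5⟩ := h
      exact ⟨ι, hι, d, π, fun l => (h1 l).trans hr, h2, h3, h4, ih h5 (by omega)⟩
  induction hn with
  | refl => exact h'
  | step _ ih => exact ih.succ

theorem HasFiniteRes.shift {n : ℕ} {M : Type} [AddCommGroup M] [Module S M]
    {ℳ ℳ' : ℕ → AddSubgroup M} {r δ : ℕ} (h : HasFiniteRes 𝒮 n M ℳ r)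
    (h1 : ∀ e a, a ∈ ℳ' (e + δ) ↔ a ∈ ℳ e) (h2 : ∀ e < δ, ∀ a ∈ ℳ' e, a = 0) :
    HasFiniteRes 𝒮 n M ℳ' (r + δ) := by
  induction n generalizing M r with
  | zero => exact h
  | succ n ih =>
    obtain ⟨ι, hι, d, π, g1, g2, g3, g4, g5⟩ := h
    have k1 : ∀ e x, x ∈ freeGr 𝒮 (fun l => d l + δ) (e + δ) ↔ x ∈ freeGr 𝒮 d e := by
      intro e x
      refine forall_congr' fun l => ?_
      change (_ → _) ∧ (_ → _) ↔ (_ → _) ∧ (_ → _)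
      simp only [add_le_add_iff_right, Nat.add_sub_add_right, add_lt_add_iff_right]
    have k2 : ∀ e < δ, ∀ x ∈ freeGr 𝒮 (fun l => d l + δ) e, x = 0 := fun e he x hx =>
      funext fun l => (hx l).2 (he.trans_le (Nat.le_add_left _ _))
    refine ⟨ι, hι, fun l => d l + δ, π, fun l => Nat.add_le_add_right (g1 l) δ, g2, ?_, ?_, ?_⟩
    · intro e x hx
      rcases le_or_gt δ e with he | he
      · obtain ⟨e, rfl⟩ := Nat.exists_eq_add_of_le' he
        exact (h1 _ _).2 (g3 _ _ ((k1 _ _).1 hx))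
      · rw [k2 e he x hx, map_zero]
        exact zero_mem _
    · intro e a ha
      rcases le_or_gt δ e with he | he
      · obtain ⟨e, rfl⟩ := Nat.exists_eq_add_of_le' he
        obtain ⟨x, hx, hxa⟩ := g4 e a ((h1 _ _).1 ha)
        exact ⟨x, (k1 _ _).2 hx, hxa⟩
      · exact ⟨0, zero_mem _, by rw [h2 e he a ha, map_zero]⟩
    · have := ih g5 (ℳ' := subGr (freeGr 𝒮 fun l => d l + δ) (LinearMap.ker π))
        (fun e a => k1 e a) (fun e he a ha => Subtype.ext (k2 e he a ha))
      rwa [add_right_comm] at this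

/-- A short exact sequence of graded modules. -/
structure IsGradedShortExact {A B C : Type} [AddCommGroup A] [Module S A] [AddCommGroup B]
    [Module S B] [AddCommGroup C] [Module S C] (𝒜 : ℕ → AddSubgroup A) (ℬ : ℕ → AddSubgroup B)
    (𝒞 : ℕ → AddSubgroup C) (α : A →ₗ[S] B) (β : B →ₗ[S] C) : Prop where
  inj : Function.Injective α
  comp : ∀ a, β (α a) = 0
  exact : ∀ b, β b = 0 → ∃ a, α a = b
  surj : Function.Surjective β
  map_mem : ∀ e a, α a ∈ ℬ e ↔ a ∈ 𝒜 e
  map_mem' : ∀ e, ∀ b ∈ ℬ e, β b ∈ 𝒞 e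
  lift : ∀ e, ∀ c ∈ 𝒞 e, ∃ b ∈ ℬ e, β b = c

theorem sum_smul_mem {M ι : Type} [AddCommGroup M] [Module S M] [Fintype ι]
    {ℳ : ℕ → AddSubgroup M} (hM : GradedSMulFamily 𝒮 ℳ) {d : ι → ℕ} {b : ι → M}
    (hb : ∀ l, b l ∈ ℳ (d l)) {e : ℕ} {x : ι → S} (hx : x ∈ freeGr 𝒮 d e) :
    ∑ l, x l • b l ∈ ℳ e := by
  refine sum_mem fun l _ => ?_
  rcases le_or_gt (d l) e with h | h
  · have := hM ((hx l).1 h) (hb l)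
    rwa [Nat.sub_add_cancel h] at this
  · rw [(hx l).2 h, zero_smul]
    exact zero_mem _

theorem HasFiniteRes.of_shortExact [SetLike.GradedMonoid 𝒮] {n r : ℕ} {A B C : Type}
    [AddCommGroup A] [Module S A]
    [AddCommGroup B] [Module S B] [AddCommGroup C] [Module S C] {𝒜 : ℕ → AddSubgroup A}
    {ℬ : ℕ → AddSubgroup B} {𝒞 : ℕ → AddSubgroup C} {α : A →ₗ[S] B} {β : B →ₗ[S] C}
    (E : IsGradedShortExact 𝒜 ℬ 𝒞 α β) (hB : GradedSMulFamily 𝒮 ℬ)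
    (hA : HasFiniteRes 𝒮 n A 𝒜 r) (hC : HasFiniteRes 𝒮 n C 𝒞 r) : HasFiniteRes 𝒮 n B ℬ r := by
  classical
  induction n generalizing A B C r with
  | zero =>
    have : Subsingleton A := hA
    have : Subsingleton C := hC
    refine ⟨fun a b => ?_⟩
    obtain ⟨x, hx⟩ := E.exact (a - b) (Subsingleton.elim _ _)
    rw [Subsingleton.elim x 0, map_zero] at hx
    exact (sub_eq_zero.1 hx.symm)
  | succ n ih =>
    obtain ⟨ι, _, dA, πA, a1, a2, a3, a4, a5⟩ := hA
    obtain ⟨κ, _, dC, πC, c1, c2, c3, c4, c5⟩ := hC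
    choose b hb hbC using fun l => E.lift _ _ (c3 _ _ (single_mem_freeGr dC l))
    let ρ : (κ → S) →ₗ[S] B := Fintype.linearCombination S b
    have hρ : ∀ x, β (ρ x) = πC x := by
      intro x
      have : β ∘ₗ ρ = πC := by
        refine LinearMap.pi_ext' fun l => LinearMap.ext_ring ?_
        simp [ρ, hbC]
      rw [← this]; rfl
    have hρm : ∀ e, ∀ x ∈ freeGr 𝒮 dC e, ρ x ∈ ℬ e := fun e x hx => by
      simpa [ρ, Fintype.linearCombination_apply] using sum_smul_mem hB hb hx
    let π : (ι ⊕ κ → S) →ₗ[S] B :=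
      α ∘ₗ πA ∘ₗ LinearMap.funLeft S S Sum.inl + ρ ∘ₗ LinearMap.funLeft S S Sum.inr
    have hπ : ∀ x, π x = α (πA (x ∘ Sum.inl)) + ρ (x ∘ Sum.inr) := fun x => rfl
    have hmem : ∀ e x, x ∈ freeGr 𝒮 (Sum.elim dA dC) e ↔
        x ∘ Sum.inl ∈ freeGr 𝒮 dA e ∧ x ∘ Sum.inr ∈ freeGr 𝒮 dC e := by
      intro e x
      change (∀ l, _) ↔ (∀ l, _) ∧ (∀ l, _)
      rw [Sum.forall]
      rfl
    refine ⟨ι ⊕ κ, inferInstance, Sum.elim dA dC, π, ?_, ?_, ?_, ?_, ?_⟩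
    · rintro (l | l)
      exacts [a1 l, c1 l]
    · intro y
      obtain ⟨x, hx⟩ := c2 (β y)
      obtain ⟨a, ha⟩ := E.exact (y - ρ x) (by rw [map_sub, hρ, hx, sub_self])
      obtain ⟨z, rfl⟩ := a2 a
      exact ⟨Sum.elim z x, by rw [hπ, Sum.elim_comp_inl, Sum.elim_comp_inr, ha]; abel⟩
    · intro e x hx
      rw [hmem] at hx
      exact add_mem ((E.map_mem _ _).2 (a3 _ _ hx.1)) (hρm _ _ hx.2)
    · intro e y hy
      obtain ⟨x, hxm, hx⟩ := c4 e _ (E.map_mem' _ _ hy)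
      obtain ⟨a, ha⟩ := E.exact (y - ρ x) (by rw [map_sub, hρ, hx, sub_self])
      obtain ⟨z, hz, rfl⟩ := a4 e a ((E.map_mem _ _).1 (by
        rw [ha]; exact sub_mem hy (hρm _ _ hxm)))
      refine ⟨Sum.elim z x, (hmem _ _).2 ?_, ?_⟩
      · rw [Sum.elim_comp_inl, Sum.elim_comp_inr]
        exact ⟨hz, hxm⟩
      · rw [hπ, Sum.elim_comp_inl, Sum.elim_comp_inr, ha]; abel
    · have k1 : ∀ x : ι → S, πA x = 0 → π (Sum.elim x 0) = 0 := fun x hx => by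
        rw [hπ, Sum.elim_comp_inl, Sum.elim_comp_inr, hx]; simp
      have k2 : ∀ x, π x = 0 → πC (x ∘ Sum.inr) = 0 := fun x hx => by
        have := congrArg β hx
        rwa [hπ, map_add, E.comp, zero_add, hρ, map_zero] at this
      have k3 : ∀ x, πC x = 0 → ∃ a, α a = ρ x := fun x hx => E.exact _ (by rw [hρ, hx])
      let α' : LinearMap.ker πA →ₗ[S] LinearMap.ker π :=
        { toFun := fun x => ⟨Sum.elim x.1 0, k1 _ x.2⟩
          map_add' := fun x y => Subtype.ext (funext fun l => by cases l <;> simp)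
          map_smul' := fun c x => Subtype.ext (funext fun l => by cases l <;> simp) }
      let β' : LinearMap.ker π →ₗ[S] LinearMap.ker πC :=
        { toFun := fun x => ⟨x.1 ∘ Sum.inr, k2 _ x.2⟩
          map_add' := fun x y => rfl
          map_smul' := fun c x => rfl }
      refine ih (α := α') (β := β') ⟨?_, ?_, ?_, ?_, ?_, ?_, ?_⟩
        ((gradedSMulFamily_free _).sub _) a5 c5
      · intro x y h
        refine Subtype.ext (funext fun l => ?_)
        exact congrFun (congrArg Subtype.val h) (Sum.inl l)
      · intro x; rfl
      · intro x hx
        have hx' : x.1 ∘ Sum.inr = 0 := congrArg Subtype.val hx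
        refine ⟨⟨x.1 ∘ Sum.inl, ?_⟩, Subtype.ext ?_⟩
        · have := x.2
          rw [LinearMap.mem_ker, hπ, hx', map_zero, add_zero] at this
          exact E.inj (this.trans (map_zero _).symm)
        · funext l
          rcases l with l | l
          · rfl
          · exact (congrFun hx' l).symm
      · intro x
        obtain ⟨a, ha⟩ := k3 _ x.2
        obtain ⟨y, rfl⟩ := a2 a
        refine ⟨⟨Sum.elim (-y) x.1, ?_⟩, Subtype.ext rfl⟩
        rw [LinearMap.mem_ker, hπ, Sum.elim_comp_inl, Sum.elim_comp_inr, ← ha]; simp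
      · intro e a
        rw [mem_subGr, hmem]
        exact and_iff_left (zero_mem _)
      · intro e x hx
        exact ((hmem _ _).1 hx).2
      · intro e x hx
        obtain ⟨a, ha⟩ := k3 _ x.2
        obtain ⟨y, hy, rfl⟩ := a4 e a ((E.map_mem _ _).1 (by rw [ha]; exact hρm _ _ hx))
        refine ⟨⟨Sum.elim (-y) x.1, ?_⟩, (hmem _ _).2 ⟨neg_mem hy, hx⟩, Subtype.ext rfl⟩
        rw [LinearMap.mem_ker, hπ, Sum.elim_comp_inl, Sum.elim_comp_inr, ← ha]; simp

theorem HasFiniteRes.of_shortExact_cokernel [SetLike.GradedMonoid 𝒮] {n r : ℕ} {A B C : Type}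
    [AddCommGroup A] [Module S A]
    [AddCommGroup B] [Module S B] [AddCommGroup C] [Module S C] {𝒜 : ℕ → AddSubgroup A}
    {ℬ : ℕ → AddSubgroup B} {𝒞 : ℕ → AddSubgroup C} {α : A →ₗ[S] B} {β : B →ₗ[S] C}
    (E : IsGradedShortExact 𝒜 ℬ 𝒞 α β)
    (hA : HasFiniteRes 𝒮 n A 𝒜 (r + 1)) (hB : HasFiniteRes 𝒮 n B ℬ r) :
    HasFiniteRes 𝒮 (n + 1) C 𝒞 r := by
  rcases n with _ | n
  · have : Subsingleton B := hB
    exact .of_subsingleton _ E.surj.subsingleton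
  · obtain ⟨ι, _, d, π, b1, b2, b3, b4, b5⟩ := hB
    refine ⟨ι, inferInstance, d, β ∘ₗ π, b1, E.surj.comp b2,
      fun e x hx => E.map_mem' _ _ (b3 _ _ hx), fun e c hc => ?_, ?_⟩
    · obtain ⟨b, hb, rfl⟩ := E.lift e c hc
      obtain ⟨x, hx, rfl⟩ := b4 e b hb
      exact ⟨x, hx, rfl⟩
    · have hr : ∀ x : LinearMap.ker (β ∘ₗ π), π x.1 ∈ LinearMap.range α := fun x =>
        E.exact _ x.2
      let γ : LinearMap.ker (β ∘ₗ π) →ₗ[S] A :=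
        (LinearEquiv.ofInjective α E.inj).symm.toLinearMap ∘ₗ
          (π ∘ₗ (LinearMap.ker (β ∘ₗ π)).subtype).codRestrict _ hr
      have hγ : ∀ x, α (γ x) = π x.1 := fun x => by
        have := LinearEquiv.apply_symm_apply (LinearEquiv.ofInjective α E.inj)
          ((π ∘ₗ (LinearMap.ker (β ∘ₗ π)).subtype).codRestrict _ hr x)
        exact congrArg Subtype.val this
      let σ : LinearMap.ker π →ₗ[S] LinearMap.ker (β ∘ₗ π) :=
        Submodule.inclusion (LinearMap.ker_le_ker_comp π β)
      refine HasFiniteRes.of_shortExact (α := σ) (β := γ) ⟨?_, ?_, ?_, ?_, ?_, ?_, ?_⟩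
        ((gradedSMulFamily_free _).sub _) (b5.mono (Nat.le_succ _) le_rfl) hA
      · exact Submodule.inclusion_injective _
      · intro a
        exact E.inj ((hγ _).trans (a.2.trans (map_zero _).symm))
      · intro x hx
        exact ⟨⟨x.1, by rw [LinearMap.mem_ker, ← hγ, hx, map_zero]⟩, rfl⟩
      · intro a
        obtain ⟨x, hx⟩ := b2 (α a)
        exact ⟨⟨x, by rw [LinearMap.mem_ker, LinearMap.comp_apply, hx, E.comp]⟩,
          E.inj ((hγ _).trans hx)⟩
      · intro e a; rfl
      · intro e x hx
        rw [← E.map_mem, hγ]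
        exact b3 _ _ hx
      · intro e a ha
        obtain ⟨x, hx, hxa⟩ := b4 e _ ((E.map_mem _ _).2 ha)
        exact ⟨⟨x, by rw [LinearMap.mem_ker, LinearMap.comp_apply, hxa, E.comp]⟩, hx,
          E.inj ((hγ _).trans hxa)⟩

theorem HasFiniteRes.shift_self {δ r : ℕ} (h : δ ≤ r) :
    HasFiniteRes 𝒮 1 S (shiftGr 𝒮 δ) r := by
  refine ⟨Unit, inferInstance, fun _ => δ, LinearMap.proj (), fun _ => h, fun s =>
    ⟨fun _ => s, rfl⟩,
    fun e x hx => hx (), fun e a ha => ⟨fun _ => a, fun _ => ha, rfl⟩, ?_⟩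
  exact ⟨fun x y => Subtype.ext (funext fun _ => (x.2.trans y.2.symm : x.1 () = y.1 ()))⟩

end Graded

section Monomial
open MvPolynomial
variable {K : Type} [Field K] {V : Type}

theorem isHomogeneous_iff_coeff {f : MvPolynomial V K} {n : ℕ} :
    f.IsHomogeneous n ↔ ∀ b, f.coeff b ≠ 0 → b.degree = n := by
  simp only [IsHomogeneous, IsWeightedHomogeneous, Finsupp.degree_eq_weight_one]
  rfl

/-- The standard grading of the polynomial ring. -/
noncomputable def homGr (K : Type) [Field K] (V : Type) (e : ℕ) : AddSubgroup (MvPolynomial V K) :=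
  (homogeneousSubmodule V K e).toAddSubgroup

theorem mem_homGr {f : MvPolynomial V K} {e : ℕ} : f ∈ homGr K V e ↔ f.IsHomogeneous e := Iff.rfl

instance : SetLike.GradedMonoid (homGr K V) where
  one_mem := isHomogeneous_one V K
  mul_mem _ _ _ _ ha hb := IsHomogeneous.mul ha hb

/-- The ideal of polynomials all of whose monomials have exponents in the upper set `U`. -/
def monIdeal (K : Type) [Field K] {V : Type} (U : Set (V →₀ ℕ)) (hU : IsUpperSet U) :
    Ideal (MvPolynomial V K) where
  carrier := {f | ∀ b, f.coeff b ≠ 0 → b ∈ U}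
  zero_mem' := fun b h => (h (coeff_zero b)).elim
  add_mem' := fun {f g} hf hg b h => by
    by_cases hb : f.coeff b = 0
    · exact hg b fun h' => h (by rw [coeff_add, hb, h', add_zero])
    · exact hf b hb
  smul_mem' := fun c f hf b h => by
    classical
    rw [smul_eq_mul, coeff_mul] at h
    obtain ⟨⟨x, y⟩, hxy, h'⟩ := Finset.exists_ne_zero_of_sum_ne_zero h
    rw [Finset.HasAntidiagonal.mem_antidiagonal] at hxy
    exact hU (hxy ▸ le_add_self) (hf y (right_ne_zero_of_mul h'))

theorem mem_monIdeal {U : Set (V →₀ ℕ)} {hU : IsUpperSet U} {f : MvPolynomial V K} :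
    f ∈ monIdeal K U hU ↔ ∀ b, f.coeff b ≠ 0 → b ∈ U := Iff.rfl

theorem coeff_monomial_one_mul (M b : V →₀ ℕ) (f : MvPolynomial V K) :
    (monomial M 1 * f).coeff (M + b) = f.coeff b := by
  rw [coeff_monomial_mul, one_mul]

theorem exists_of_coeff_monomial_one_mul {M b : V →₀ ℕ} {f : MvPolynomial V K}
    (h : (monomial M 1 * f).coeff b ≠ 0) : ∃ c, b = M + c ∧ f.coeff c ≠ 0 := by
  classical
  rw [coeff_monomial_mul'] at h
  split_ifs at h with hb
  · obtain ⟨c, rfl⟩ := exists_add_of_le hb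
    exact ⟨c, rfl, by simpa using h⟩
  · exact (h rfl).elim

theorem monomial_mul_mem_monIdeal {U : Set (V →₀ ℕ)} {hU : IsUpperSet U} {M : V →₀ ℕ}
    {f : MvPolynomial V K} :
    monomial M 1 * f ∈ monIdeal K U hU ↔ ∀ b, f.coeff b ≠ 0 → M + b ∈ U := by
  rw [mem_monIdeal]
  constructor
  · intro h b hb
    exact h _ (by rwa [coeff_monomial_one_mul])
  · intro h b hb
    obtain ⟨c, rfl, hc⟩ := exists_of_coeff_monomial_one_mul hb
    exact h c hc

theorem monomial_mul_mem_homGr {M : V →₀ ℕ} {f : MvPolynomial V K} {e : ℕ} :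
    monomial M 1 * f ∈ homGr K V e ↔ f ∈ shiftGr (homGr K V) M.degree e := by
  rw [mem_homGr, isHomogeneous_iff_coeff]
  constructor
  · intro h
    have h' : ∀ b, f.coeff b ≠ 0 → M.degree + b.degree = e := fun b hb => by
      rw [← map_add]
      exact h _ (by rwa [coeff_monomial_one_mul])
    refine ⟨fun he => ?_, fun he => ?_⟩
    · rw [mem_homGr, isHomogeneous_iff_coeff]
      intro b hb
      have := h' b hb
      omega
    · ext b
      by_contra hb
      have := h' b hb
      omega
  · intro h b hb
    obtain ⟨c, rfl, hc⟩ := exists_of_coeff_monomial_one_mul hb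
    rw [map_add]
    rcases le_or_gt M.degree e with he | he
    · have := isHomogeneous_iff_coeff.1 (h.1 he) c hc
      omega
    · rw [h.2 he] at hc
      exact (hc (coeff_zero c)).elim

theorem coeff_divMonomial_ne {M b : V →₀ ℕ} {f : MvPolynomial V K}
    (h : (f.divMonomial M).coeff b ≠ 0) : f.coeff (M + b) ≠ 0 := by
  rwa [coeff_divMonomial] at h

theorem coeff_modMonomial_ne {M b : V →₀ ℕ} {f : MvPolynomial V K}
    (h : (f.modMonomial M).coeff b ≠ 0) : f.coeff b ≠ 0 ∧ ¬ M ≤ b := by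
  by_cases hb : M ≤ b
  · rw [coeff_modMonomial_of_le _ hb] at h
    exact (h rfl).elim
  · rw [coeff_modMonomial_of_not_le _ hb] at h
    exact ⟨h, hb⟩

/-- The monomial ideal of the upper set `U` has a finite graded free resolution whose `i`-th module
is generated in degrees at most `i + r`. -/
def HasMonRes (K : Type) [Field K] {V : Type} (U : Set (V →₀ ℕ)) (r : ℕ) : Prop :=
  ∃ (hU : IsUpperSet U) (n : ℕ), HasFiniteRes (homGr K V) n (monIdeal K U hU)
    (subGr (homGr K V) (monIdeal K U hU)) r

theorem HasMonRes.mono {U : Set (V →₀ ℕ)} {r r' : ℕ} (h : HasMonRes K U r) (hr : r ≤ r') :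
    HasMonRes K U r' :=
  let ⟨hU, n, h⟩ := h
  ⟨hU, n, h.mono le_rfl hr⟩

theorem hasMonRes_empty (r : ℕ) : HasMonRes K (∅ : Set (V →₀ ℕ)) r := by
  refine ⟨fun _ _ _ h => h, 0, ⟨fun x y => Subtype.ext ?_⟩⟩
  have (x : monIdeal K (∅ : Set (V →₀ ℕ)) fun _ _ _ h => h) : x.1 = 0 := by
    ext b
    by_contra h
    exact x.2 b h
  rw [this, this]

theorem isUpperSet_or {U : Set (V →₀ ℕ)} (hU : IsUpperSet U) (M : V →₀ ℕ) :
    IsUpperSet {m | m ∈ U ∨ M ≤ m} :=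
  fun _ _ hab h => h.imp (hU hab) (le_trans · hab)

theorem isUpperSet_colon {U : Set (V →₀ ℕ)} (hU : IsUpperSet U) (M : V →₀ ℕ) :
    IsUpperSet {m | M + m ∈ U} :=
  fun _ _ hab h => hU (by gcongr) h

theorem exists_isGradedShortExact {U : Set (V →₀ ℕ)} (hU : IsUpperSet U) (M : V →₀ ℕ) :
    ∃ (α : monIdeal K _ (isUpperSet_colon hU M) →ₗ[MvPolynomial V K]
        monIdeal K U hU × MvPolynomial V K)
      (β : monIdeal K U hU × MvPolynomial V K →ₗ[MvPolynomial V K]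
        monIdeal K _ (isUpperSet_or hU M)),
      IsGradedShortExact (shiftGr (subGr (homGr K V) _) M.degree)
        (fun e => (subGr (homGr K V) _ e).prod (shiftGr (homGr K V) M.degree e))
        (subGr (homGr K V) _) α β := by
  have hα : ∀ a : monIdeal K _ (isUpperSet_colon hU M), monomial M 1 * a.1 ∈ monIdeal K U hU :=
    fun a => monomial_mul_mem_monIdeal.2 a.2
  have hβ : ∀ x : monIdeal K U hU × MvPolynomial V K,
      x.1.1 - monomial M 1 * x.2 ∈ monIdeal K _ (isUpperSet_or hU M) := fun x =>
    sub_mem (fun b hb => Or.inl (x.1.2 b hb))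
      (monomial_mul_mem_monIdeal.2 fun b _ => Or.inr le_self_add)
  have hsplit : ∀ f ∈ monIdeal K _ (isUpperSet_or hU M), f.modMonomial M ∈ monIdeal K U hU :=
    fun f hf b hb => (hf b (coeff_modMonomial_ne hb).1).resolve_right (coeff_modMonomial_ne hb).2
  have hadd : ∀ f : MvPolynomial V K,
      f.modMonomial M - monomial M 1 * -f.divMonomial M = f := fun f => by
    rw [mul_neg, sub_neg_eq_add]
    exact modMonomial_add_divMonomial f M
  refine ⟨{ toFun := fun a => (⟨_, hα a⟩, a.1)
            map_add' := fun a b => Prod.ext (Subtype.ext (mul_add _ _ _)) rfl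
            map_smul' := fun c a => Prod.ext (Subtype.ext (mul_left_comm _ _ _)) rfl },
    { toFun := fun x => ⟨_, hβ x⟩
      map_add' := fun x y => Subtype.ext ?_
      map_smul' := fun c x => Subtype.ext ?_ }, ?_, ?_, ?_, ?_, ?_, ?_, ?_⟩
  · change (x.1.1 + y.1.1) - monomial M 1 * (x.2 + y.2) = _ - _ + (_ - _)
    ring
  · change c * x.1.1 - monomial M 1 * (c * x.2) = c * (_ - _)
    ring
  · intro a b h
    exact Subtype.ext (congrArg Prod.snd h)
  · intro a
    exact Subtype.ext (sub_self _)
  · rintro ⟨a, g⟩ h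
    have h' : a.1 = monomial M 1 * g := sub_eq_zero.1 (congrArg Subtype.val h)
    exact ⟨⟨g, monomial_mul_mem_monIdeal.1 (h' ▸ a.2)⟩, Prod.ext (Subtype.ext h'.symm) rfl⟩
  · intro f
    exact ⟨(⟨_, hsplit f.1 f.2⟩, -f.1.divMonomial M), Subtype.ext (hadd f.1)⟩
  · intro e a
    have h1 : a ∈ shiftGr (subGr (homGr K V) _) M.degree e ↔
        a.1 ∈ shiftGr (homGr K V) M.degree e := by
      change (_ → _) ∧ (_ → _) ↔ (_ → _) ∧ (_ → _)
      rw [← Subtype.val_inj]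
      rfl
    rw [h1]
    change monomial M 1 * a.1 ∈ homGr K V e ∧ a.1 ∈ shiftGr (homGr K V) M.degree e ↔ _
    rw [monomial_mul_mem_homGr, and_self]
  · intro e x hx
    have hx1 : x.1.1 ∈ homGr K V e := hx.1
    have hx2 : monomial M 1 * x.2 ∈ homGr K V e := monomial_mul_mem_homGr.2 hx.2
    exact (sub_mem hx1 hx2 : x.1.1 - monomial M 1 * x.2 ∈ homGr K V e)
  · intro e f hf
    have hf' := isHomogeneous_iff_coeff.1 hf
    have h1 : f.1.modMonomial M ∈ homGr K V e :=
      isHomogeneous_iff_coeff.2 fun b hb => hf' b (coeff_modMonomial_ne hb).1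
    have h2 : f.1.divMonomial M ∈ shiftGr (homGr K V) M.degree e := by
      rw [← monomial_mul_mem_homGr, mem_homGr, isHomogeneous_iff_coeff]
      intro b hb
      obtain ⟨c, rfl, hc⟩ := exists_of_coeff_monomial_one_mul hb
      exact hf' _ (coeff_divMonomial_ne hc)
    have h2' := neg_mem h2
    exact ⟨(⟨_, hsplit f.1 f.2⟩, -f.1.divMonomial M), ⟨h1, h2'⟩, Subtype.ext (hadd f.1)⟩

theorem HasFiniteRes.shiftGr {n r δ : ℕ} {M : Type} [AddCommGroup M] [Module (MvPolynomial V K) M]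
    {ℳ : ℕ → AddSubgroup M} (h : HasFiniteRes (homGr K V) n M ℳ r) :
    HasFiniteRes (homGr K V) n M (shiftGr ℳ δ) (r + δ) :=
  h.shift (fun _ _ => mem_shiftGr_add) fun _ he _ ha => eq_zero_of_mem_shiftGr he ha

theorem isGradedShortExact_prod {S A B : Type} [CommRing S] [AddCommGroup A] [Module S A]
    [AddCommGroup B] [Module S B] (𝒜 : ℕ → AddSubgroup A) (ℬ : ℕ → AddSubgroup B) :
    IsGradedShortExact ℬ (fun e => (𝒜 e).prod (ℬ e)) 𝒜 (LinearMap.inr S A B)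
      (LinearMap.fst S A B) where
  inj := LinearMap.inr_injective
  comp _ := rfl
  exact x hx := ⟨x.2, Prod.ext hx.symm rfl⟩
  surj := LinearMap.fst_surjective
  map_mem _ _ := ⟨fun h => h.2, fun h => ⟨zero_mem _, h⟩⟩
  map_mem' _ _ hx := hx.1
  lift _ a ha := ⟨(a, 0), ⟨ha, zero_mem _⟩, rfl⟩

theorem gradedSMulFamily_monIdeal_prod {U : Set (V →₀ ℕ)} (hU : IsUpperSet U) (δ : ℕ) :
    GradedSMulFamily (homGr K V) fun e =>
      (subGr (homGr K V) (monIdeal K U hU) e).prod (shiftGr (homGr K V) δ e) :=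
  (gradedSMulFamily_self.sub _).prod (gradedSMulFamily_self.shift δ)

theorem HasMonRes.of_or_of_colon {U : Set (V →₀ ℕ)} {M : V →₀ ℕ} {r r' : ℕ}
    (hU : IsUpperSet U) (h : HasMonRes K {m | m ∈ U ∨ M ≤ m} r)
    (h' : HasMonRes K {m | M + m ∈ U} r') (hr : r' + M.degree ≤ r) : HasMonRes K U r := by
  obtain ⟨_, n, h⟩ := h
  obtain ⟨_, n', h'⟩ := h'
  obtain ⟨α, β, E⟩ := exists_isGradedShortExact (K := K) hU M
  refine ⟨hU, max 1 (max n n') + 1, ?_⟩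
  refine HasFiniteRes.of_shortExact_cokernel (isGradedShortExact_prod _ _)
    ((HasFiniteRes.shift_self (δ := M.degree) (r := r + 1) (by omega)).mono (by simp) le_rfl) ?_
  exact HasFiniteRes.of_shortExact E (gradedSMulFamily_monIdeal_prod hU _)
    (h'.shiftGr.mono (by omega) hr) (h.mono (by omega) le_rfl)

theorem HasMonRes.or_of_colon {U : Set (V →₀ ℕ)} {M : V →₀ ℕ} {r r' : ℕ}
    (h : HasMonRes K U r) (h' : HasMonRes K {m | M + m ∈ U} r') (hr : r' + M.degree ≤ r + 1)
    (hM : M.degree ≤ r) : HasMonRes K {m | m ∈ U ∨ M ≤ m} r := by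
  obtain ⟨hU, n, h⟩ := h
  obtain ⟨_, n', h'⟩ := h'
  obtain ⟨α, β, E⟩ := exists_isGradedShortExact (K := K) hU M
  refine ⟨isUpperSet_or hU M, max 1 (max n n') + 1, ?_⟩
  refine HasFiniteRes.of_shortExact_cokernel E (h'.shiftGr.mono (by omega) hr) ?_
  exact HasFiniteRes.of_shortExact (isGradedShortExact_prod _ _)
    (gradedSMulFamily_monIdeal_prod hU _)
    ((HasFiniteRes.shift_self hM).mono (by omega) le_rfl) (h.mono (by omega) le_rfl)

theorem hasMonRes_univ (r : ℕ) : HasMonRes K (Set.univ : Set (V →₀ ℕ)) r := by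
  have := (hasMonRes_empty (K := K) (V := V) r).or_of_colon (M := 0) (r' := 0)
    (by simpa using hasMonRes_empty (K := K) (V := V) 0) (by simp) (by simp)
  simpa using this

theorem hasMonRes_vars [Finite V] (X : Set V) :
    HasMonRes K {m : V →₀ ℕ | ∃ v ∈ X, Finsupp.single v 1 ≤ m} 1 := by
  induction X, X.toFinite using Set.Finite.induction_on with
  | empty => simpa using hasMonRes_empty (K := K) (V := V) 1
  | @insert a X ha _ ih =>
    have := ih.or_of_colon (M := Finsupp.single a 1) (r' := 1) ?_ (by simp) (by simp)
    · convert this using 1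
      ext m
      simp [or_comm]
    · convert ih using 1
      ext m
      refine exists_congr fun v => and_congr_right fun hv => ?_
      have : a ≠ v := fun h => ha (h ▸ hv)
      simp [this]

end Monomial

section Exchange
variable {V : Type}

/-- The exponent vector of the monomial of an edge. -/
noncomputable def edgeExp : Sym2 V → (V →₀ ℕ) :=
  Sym2.lift ⟨fun a b => Finsupp.single a 1 + Finsupp.single b 1, fun _ _ => add_comm _ _⟩

/-- The exponent vector of a product of edges. -/
noncomputable def edgesExp (P : Multiset (Sym2 V)) : V →₀ ℕ := (P.map edgeExp).sum

@[simp] theorem edgesExp_zero : edgesExp (0 : Multiset (Sym2 V)) = 0 := rfl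

@[simp] theorem edgesExp_cons (y z : V) (P : Multiset (Sym2 V)) :
    edgesExp (s(y, z) ::ₘ P) = Finsupp.single y 1 + Finsupp.single z 1 + edgesExp P := by
  simp [edgesExp, edgeExp]

theorem degree_edgesExp (P : Multiset (Sym2 V)) : (edgesExp P).degree = 2 * P.card := by
  induction P using Multiset.induction_on with
  | empty => simp
  | cons e P ih =>
    induction e using Sym2.ind
    rw [edgesExp_cons, map_add, map_add, ih]
    simp
    ring

variable {G : SimpleGraph V} {A : Set V}

/-- All members of `P` are edges of the subgraph of `G` induced on `A`. -/
def IsEdges (G : SimpleGraph V) (A : Set V) (P : Multiset (Sym2 V)) : Prop :=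
  ∀ e ∈ P, e ∈ G.edgeSet ∧ ∀ v ∈ e, v ∈ A

theorem isEdges_zero : IsEdges G A 0 := fun _ h => (Multiset.notMem_zero _ h).elim

theorem isEdges_cons {y z : V} {P : Multiset (Sym2 V)} :
    IsEdges G A (s(y, z) ::ₘ P) ↔ G.Adj y z ∧ y ∈ A ∧ z ∈ A ∧ IsEdges G A P := by
  simp [IsEdges, and_assoc]

theorem IsEdges.mono {B : Set V} {P : Multiset (Sym2 V)} (h : IsEdges G A P) (hAB : A ⊆ B) :
    IsEdges G B P := fun e he => ⟨(h e he).1, fun v hv => hAB ((h e he).2 v hv)⟩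

/-- `m` is divisible by a product of `k` edges of the subgraph induced on `A`. -/
def EdgeDvd (G : SimpleGraph V) (A : Set V) (k : ℕ) (m : V →₀ ℕ) : Prop :=
  ∃ L, IsEdges G A L ∧ L.card = k ∧ edgesExp L ≤ m

theorem EdgeDvd.le {k : ℕ} {m m' : V →₀ ℕ} (h : EdgeDvd G A k m) (hm : m ≤ m') :
    EdgeDvd G A k m' :=
  let ⟨L, h1, h2, h3⟩ := h
  ⟨L, h1, h2, h3.trans hm⟩

theorem EdgeDvd.mono {B : Set V} {k : ℕ} {m : V →₀ ℕ} (h : EdgeDvd G A k m) (hAB : A ⊆ B) :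
    EdgeDvd G B k m :=
  let ⟨L, h1, h2, h3⟩ := h
  ⟨L, h1.mono hAB, h2, h3⟩

theorem EdgeDvd.of_le {k l : ℕ} {m : V →₀ ℕ} (h : EdgeDvd G A l m) (hk : k ≤ l) :
    EdgeDvd G A k m := by
  induction hk with
  | refl => exact h
  | @step l hk ih =>
    obtain ⟨L, h1, h2, h3⟩ := h
    obtain ⟨e, he⟩ := Multiset.card_pos_iff_exists_mem.1 (by omega : 0 < L.card)
    obtain ⟨L, rfl⟩ := Multiset.exists_cons_of_mem he
    induction e using Sym2.ind
    rw [isEdges_cons] at h1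
    rw [edgesExp_cons] at h3
    exact ih ⟨L, h1.2.2.2, by simpa using h2, le_add_self.trans h3⟩

theorem edgeDvd_self {P : Multiset (Sym2 V)} (hP : IsEdges G A P) :
    EdgeDvd G A P.card (edgesExp P) := ⟨P, hP, rfl, le_rfl⟩

theorem EdgeDvd.cons {k : ℕ} {m m' : V →₀ ℕ} {y z : V} (h : EdgeDvd G A k m) (hyz : G.Adj y z)
    (hy : y ∈ A) (hz : z ∈ A) (hm : Finsupp.single y 1 + Finsupp.single z 1 + m ≤ m') :
    EdgeDvd G A (k + 1) m' := by
  obtain ⟨L, h1, h2, h3⟩ := h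
  refine ⟨s(y, z) ::ₘ L, isEdges_cons.2 ⟨hyz, hy, hz, h1⟩, by simp [h2], le_trans ?_ hm⟩
  rw [edgesExp_cons]
  gcongr

theorem exists_cons_of_edgesExp_ne_zero {L : Multiset (Sym2 V)} {x : V}
    (hx : edgesExp L x ≠ 0) : ∃ y L', L = s(x, y) ::ₘ L' := by
  induction L using Multiset.induction_on with
  | empty => simp at hx
  | cons e L ih =>
    by_cases hxe : x ∈ e
    · obtain ⟨y, rfl⟩ := hxe
      exact ⟨y, L, rfl⟩
    · obtain ⟨y, L', rfl⟩ := ih (by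
        induction e using Sym2.ind with
        | _ a b =>
          rw [Sym2.mem_iff, not_or] at hxe
          simpa [Finsupp.single_apply, Ne.symm hxe.1, Ne.symm hxe.2] using hx)
      exact ⟨y, e ::ₘ L', Multiset.cons_swap _ _ _⟩

/-- An alternating walk from `x` to `y`: it starts and ends with an edge of `G`, and every second
edge is a member of `P`. -/
inductive AltWalk (G : SimpleGraph V) (A : Set V) : Multiset (Sym2 V) → V → V → Prop
  | edge {P : Multiset (Sym2 V)} {x y : V} : G.Adj x y → x ∈ A → y ∈ A → AltWalk G A P x y
  | symm {P : Multiset (Sym2 V)} {x y : V} : AltWalk G A P x y → AltWalk G A P y x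
  | step {P : Multiset (Sym2 V)} {x y z v : V} : G.Adj x y → x ∈ A → y ∈ A → AltWalk G A P z v →
      AltWalk G A (s(y, z) ::ₘ P) x v

theorem AltWalk.cons {P : Multiset (Sym2 V)} {x y : V} (h : AltWalk G A P x y) (e : Sym2 V) :
    AltWalk G A (e ::ₘ P) x y := by
  induction h with
  | edge h hx hy => exact .edge h hx hy
  | symm _ ih => exact ih.symm
  | step h hx hy _ ih =>
    rw [Multiset.cons_swap]
    exact .step h hx hy ih

theorem AltWalk.edgeDvd {P : Multiset (Sym2 V)} {x y : V} (h : AltWalk G A P x y)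
    (hP : IsEdges G A P) :
    EdgeDvd G A (P.card + 1) (edgesExp P + Finsupp.single x 1 + Finsupp.single y 1) := by
  induction h with
  | edge h hx hy => exact (edgeDvd_self hP).cons h hx hy (le_of_eq (by abel))
  | symm _ ih =>
    rw [add_right_comm]
    exact ih hP
  | step h hx hy _ ih =>
    rw [Multiset.card_cons]
    refine (ih (isEdges_cons.1 hP).2.2.2).cons h hx hy (le_of_eq ?_)
    rw [edgesExp_cons]
    abel

/-- A walk from `x` to `y` in which the first edge is an edge of `G`, the last one is a member of
`P`, and the two kinds alternate. -/
inductive HalfWalk (G : SimpleGraph V) (A : Set V) : Multiset (Sym2 V) → V → V → Prop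
  | refl {P : Multiset (Sym2 V)} {x : V} : HalfWalk G A P x x
  | step {P : Multiset (Sym2 V)} {x y z v : V} : G.Adj x y → x ∈ A → y ∈ A → HalfWalk G A P z v →
      HalfWalk G A (s(y, z) ::ₘ P) x v

theorem HalfWalk.cons {P : Multiset (Sym2 V)} {x y : V} (h : HalfWalk G A P x y) (e : Sym2 V) :
    HalfWalk G A (e ::ₘ P) x y := by
  induction h with
  | refl => exact .refl
  | step h hx hy _ ih =>
    rw [Multiset.cons_swap]
    exact .step h hx hy ih

theorem HalfWalk.exists_edges {P : Multiset (Sym2 V)} {x y : V} (h : HalfWalk G A P x y)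
    (hP : IsEdges G A P) : ∃ N, IsEdges G A N ∧ N.card = P.card ∧
      edgesExp P + Finsupp.single x 1 = edgesExp N + Finsupp.single y 1 := by
  induction h with
  | refl => exact ⟨_, hP, rfl, rfl⟩
  | @step P x y z v h hx hy _ ih =>
    obtain ⟨N, h1, h2, h3⟩ := ih (isEdges_cons.1 hP).2.2.2
    refine ⟨s(x, y) ::ₘ N, isEdges_cons.2 ⟨h, hx, hy, h1⟩, by simp [h2], ?_⟩
    rw [edgesExp_cons, edgesExp_cons]
    calc _ = Finsupp.single x 1 + Finsupp.single y 1 + (edgesExp P + Finsupp.single z 1) := by abel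
      _ = _ := by rw [h3]; abel

theorem exists_lt_of_degree_lt {a b : V →₀ ℕ} (h : a.degree < b.degree) : ∃ x, a x < b x := by
  by_contra! h'
  exact absurd (Finsupp.degree_mono (show b ≤ a from h')) (not_le.2 h)

theorem single_le_of_pos {m : V →₀ ℕ} {x : V} (h : 0 < m x) : Finsupp.single x 1 ≤ m := by
  simpa using Nat.one_le_iff_ne_zero.2 h.ne'

theorem le_of_le_add_single {a m : V →₀ ℕ} {z : V} (h : a ≤ m + Finsupp.single z 1)
    (hz : a z = 0) : a ≤ m := by
  classical
  intro v
  have := h v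
  rcases eq_or_ne z v with rfl | hv
  · omega
  · simpa [Finsupp.single_apply, hv] using this

/-- One exchange step, shared by the two exchange lemmas below. -/
theorem exchange_step {P N : Multiset (Sym2 V)} {m : V →₀ ℕ} {x : V} (hN : IsEdges G A N)
    (h : edgesExp N ≤ edgesExp P + m) (hx : edgesExp P x < edgesExp N x) :
    ∃ y m' N', N = s(x, y) ::ₘ N' ∧ m = m' + Finsupp.single x 1 ∧
      (Finsupp.single x 1 + Finsupp.single y 1 ≤ m ∨
        ∃ z P', P = s(y, z) ::ₘ P' ∧ edgesExp N' ≤ edgesExp P' + (m' + Finsupp.single z 1)) := by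
  classical
  obtain ⟨y, N', rfl⟩ := exists_cons_of_edgesExp_ne_zero (by omega : edgesExp N x ≠ 0)
  have hmx : 0 < m x := by
    have := h x
    rw [Finsupp.add_apply] at this
    omega
  obtain ⟨m', rfl⟩ := exists_add_of_le (single_le_of_pos hmx)
  refine ⟨y, m', N', rfl, add_comm _ _, ?_⟩
  by_cases hy : edgesExp P y = 0
  · left
    gcongr
    refine single_le_of_pos ?_
    have := h y
    simp only [edgesExp_cons, Finsupp.add_apply, Finsupp.single_apply,
      (isEdges_cons.1 hN).1.ne, if_false, if_true] at this
    omega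
  · right
    obtain ⟨z, P', rfl⟩ := exists_cons_of_edgesExp_ne_zero hy
    refine ⟨z, P', rfl, fun a => ?_⟩
    have := h a
    simp only [edgesExp_cons, Finsupp.add_apply] at this ⊢
    omega

theorem AltWalk.extend {P : Multiset (Sym2 V)} {m : V →₀ ℕ} {x y z : V} (hxy : G.Adj x y)
    (hx : x ∈ A) (hy : y ∈ A)
    (h : ∃ u v, AltWalk G A P u v ∧
      Finsupp.single u 1 + Finsupp.single v 1 ≤ m + Finsupp.single z 1) :
    ∃ u v, AltWalk G A (s(y, z) ::ₘ P) u v ∧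
      Finsupp.single u 1 + Finsupp.single v 1 ≤ m + Finsupp.single x 1 := by
  classical
  have key : ∀ v, AltWalk G A P z v →
      Finsupp.single v 1 + Finsupp.single z 1 ≤ m + Finsupp.single z 1 →
      ∃ u v, AltWalk G A (s(y, z) ::ₘ P) u v ∧
      Finsupp.single u 1 + Finsupp.single v 1 ≤ m + Finsupp.single x 1 := fun v hv hm =>
    ⟨x, v, .step hxy hx hy hv, by
      rw [add_comm]
      exact add_le_add_left (le_of_add_le_add_right hm) _⟩
  obtain ⟨u, v, hW, hm⟩ := h
  rcases eq_or_ne u z with rfl | hu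
  · exact key v hW (by rwa [add_comm])
  rcases eq_or_ne v z with rfl | hv
  · exact key u hW.symm hm
  · refine ⟨u, v, hW.cons _, (le_of_le_add_single hm ?_).trans le_self_add⟩
    simp [hu, hv]

theorem exists_altWalk {P N : Multiset (Sym2 V)} {m : V →₀ ℕ} (hN : IsEdges G A N)
    (hc : N.card = P.card + 1) (h : edgesExp N ≤ edgesExp P + m) :
    ∃ u v, AltWalk G A P u v ∧ Finsupp.single u 1 + Finsupp.single v 1 ≤ m := by
  induction hk : P.card generalizing P N m with
  | zero =>
    obtain ⟨x, hx⟩ := exists_lt_of_degree_lt (a := edgesExp P) (b := edgesExp N)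
      (by rw [degree_edgesExp, degree_edgesExp]; omega)
    obtain ⟨y, m', N', rfl, rfl, h' | ⟨z, P', rfl, -⟩⟩ := exchange_step hN h hx
    · exact ⟨x, y, .edge (isEdges_cons.1 hN).1 (isEdges_cons.1 hN).2.1
        (isEdges_cons.1 hN).2.2.1, h'⟩
    · simp at hk
  | succ k ih =>
    obtain ⟨x, hx⟩ := exists_lt_of_degree_lt (a := edgesExp P) (b := edgesExp N)
      (by rw [degree_edgesExp, degree_edgesExp]; omega)
    obtain ⟨y, m', N', rfl, rfl, h' | ⟨z, P', rfl, h'⟩⟩ := exchange_step hN h hx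
    · exact ⟨x, y, .edge (isEdges_cons.1 hN).1 (isEdges_cons.1 hN).2.1
        (isEdges_cons.1 hN).2.2.1, h'⟩
    · rw [isEdges_cons] at hN
      simp only [Multiset.card_cons, add_left_inj] at hc hk
      exact AltWalk.extend hN.1 hN.2.1 hN.2.2.1 (ih hN.2.2.2 (by omega) h' hk)

theorem exists_altWalk_or_halfWalks {P N : Multiset (Sym2 V)} {m : V →₀ ℕ} (hN : IsEdges G A N)
    (hc : N.card = P.card) (h : edgesExp N ≤ edgesExp P + m) :
    (∃ u v, AltWalk G A P u v ∧ Finsupp.single u 1 + Finsupp.single v 1 ≤ m) ∨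
      ∃ l : Multiset (V × V), (∀ p ∈ l, HalfWalk G A P p.1 p.2) ∧
        (l.map fun p => Finsupp.single p.1 1).sum ≤ m ∧
        edgesExp P + (l.map fun p => Finsupp.single p.1 1).sum =
          edgesExp N + (l.map fun p => Finsupp.single p.2 1).sum := by
  classical
  induction hk : P.card generalizing P N m with
  | zero =>
    refine Or.inr ⟨0, by simp, by simp, ?_⟩
    rw [Multiset.card_eq_zero.1 hk, Multiset.card_eq_zero.1 (hc.trans hk)]
    simp
  | succ k ih =>
    by_cases hx : ∃ x, edgesExp P x < edgesExp N x
    · obtain ⟨x, hx⟩ := hx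
      obtain ⟨y, m', N', rfl, rfl, h' | ⟨z, P', rfl, h'⟩⟩ := exchange_step hN h hx
      · exact Or.inl ⟨x, y, .edge (isEdges_cons.1 hN).1 (isEdges_cons.1 hN).2.1
          (isEdges_cons.1 hN).2.2.1, h'⟩
      rw [isEdges_cons] at hN
      obtain ⟨hxy, hxA, hyA, hN⟩ := hN
      simp only [Multiset.card_cons, add_left_inj] at hc hk
      rcases ih hN hc h' hk with hW | ⟨l, h1, h2, h3⟩
      · exact Or.inl (AltWalk.extend hxy hxA hyA hW)
      right
      by_cases hz : ∃ u, (z, u) ∈ l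
      · obtain ⟨u, hu⟩ := hz
        obtain ⟨l, rfl⟩ := Multiset.exists_cons_of_mem hu
        simp only [Multiset.mem_cons, forall_eq_or_imp, Multiset.map_cons,
          Multiset.sum_cons] at h1 h2 h3
        refine ⟨(x, u) ::ₘ l, ?_, ?_, ?_⟩
        · simp only [Multiset.mem_cons, forall_eq_or_imp]
          exact ⟨.step hxy hxA hyA h1.1, fun p hp => (h1.2 p hp).cons _⟩
        · intro a
          have := h2 a
          simp only [Multiset.map_cons, Multiset.sum_cons, Finsupp.add_apply] at this ⊢
          omega
        · ext a
          have := DFunLike.congr_fun h3 a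
          simp only [Multiset.map_cons, Multiset.sum_cons, Finsupp.add_apply,
            edgesExp_cons] at this ⊢
          omega
      · push Not at hz
        have h2' := le_of_le_add_single h2 (by
          rw [← Finsupp.applyAddHom_apply, map_multiset_sum, Multiset.map_map]
          refine Multiset.sum_eq_zero fun n hn => ?_
          obtain ⟨p, hp, rfl⟩ := Multiset.mem_map.1 hn
          have : p.1 ≠ z := fun h => hz p.2 (h ▸ hp)
          simp [this])
        refine ⟨(x, z) ::ₘ l, ?_, ?_, ?_⟩
        · simp only [Multiset.mem_cons, forall_eq_or_imp]
          exact ⟨.step hxy hxA hyA .refl, fun p hp => (h1 p hp).cons _⟩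
        · rw [Multiset.map_cons, Multiset.sum_cons, add_comm]
          gcongr
        · ext a
          have := DFunLike.congr_fun h3 a
          simp only [Multiset.map_cons, Multiset.sum_cons, Finsupp.add_apply,
            edgesExp_cons] at this ⊢
          omega
    · push Not at hx
      refine Or.inr ⟨0, by simp, by simp, ?_⟩
      simp only [Multiset.map_zero, Multiset.sum_zero, add_zero]
      obtain ⟨c, hPc⟩ := exists_add_of_le (show edgesExp N ≤ edgesExp P from hx)
      have := congrArg Finsupp.degree hPc
      rw [map_add, degree_edgesExp, degree_edgesExp, hc, left_eq_add,
        Finsupp.degree_eq_zero_iff] at this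
      rw [hPc, this, add_zero]

end Exchange

section Deletion
variable {V : Type} {G : SimpleGraph V} {A : Set V}

open Classical in
/-- The members of `P` with both ends in `B`. -/
noncomputable def edgesIn (P : Multiset (Sym2 V)) (B : Set V) : Multiset (Sym2 V) :=
  P.filter fun e => ∀ v ∈ e, v ∈ B

theorem edgesIn_cons_of_mem {P : Multiset (Sym2 V)} {B : Set V} {y z : V} (hy : y ∈ B)
    (hz : z ∈ B) : edgesIn (s(y, z) ::ₘ P) B = s(y, z) ::ₘ edgesIn P B := by
  classical
  exact Multiset.filter_cons_of_pos _ (by simp [hy, hz])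

theorem isEdges_edgesIn {P : Multiset (Sym2 V)} (hP : IsEdges G A P) (B : Set V) :
    IsEdges G B (edgesIn P B) := by
  classical
  intro e he
  obtain ⟨h1, h2⟩ := Multiset.mem_filter.1 he
  exact ⟨(hP e h1).1, h2⟩

theorem EdgeDvd.of_edgesIn {P : Multiset (Sym2 V)} {B : Set V} {k : ℕ} {m : V →₀ ℕ}
    (hP : IsEdges G A P) (hB : B ⊆ A)
    (h : EdgeDvd G B ((edgesIn P B).card + k) (edgesExp (edgesIn P B) + m)) :
    EdgeDvd G A (P.card + k) (edgesExp P + m) := by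
  classical
  obtain ⟨Q, hQ⟩ := Multiset.le_iff_exists_add.1 (show edgesIn P B ≤ P from Multiset.filter_le _ _)
  obtain ⟨L, h1, h2, h3⟩ := h
  have hexp : ∀ P Q : Multiset (Sym2 V), edgesExp (P + Q) = edgesExp P + edgesExp Q := fun P Q => by
    simp [edgesExp]
  refine ⟨L + Q, fun e he => ?_, ?_, ?_⟩
  · rcases Multiset.mem_add.1 he with he | he
    · exact h1.mono hB e he
    · exact hP e (hQ ▸ Multiset.mem_add.2 (Or.inr he))
  · have := congrArg Multiset.card hQ
    rw [Multiset.card_add] at this ⊢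
    omega
  · have := congrArg edgesExp hQ
    rw [hexp] at this
    rw [hexp, this, add_right_comm]
    gcongr

/-- The vertices `y` such that `w` times a product of as many edges as in `P` divides
`y` times `P`. -/
def exchangeable (G : SimpleGraph V) (A : Set V) (P : Multiset (Sym2 V)) (w : V) : Set V :=
  {y | ∃ L, IsEdges G A L ∧ L.card = P.card ∧
    edgesExp L + Finsupp.single w 1 ≤ edgesExp P + Finsupp.single y 1}

theorem exchangeable_cons {P : Multiset (Sym2 V)} {w x y y' z v : V}
    (h : z ∈ exchangeable G A P w) (hxy : G.Adj x y) (hx : x ∈ A) (hy : y ∈ A)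
    (hz : Finsupp.single x 1 + Finsupp.single y 1 + Finsupp.single z 1 + edgesExp P ≤
      edgesExp (s(y, y') ::ₘ P) + Finsupp.single v 1) :
    v ∈ exchangeable G A (s(y, y') ::ₘ P) w := by
  obtain ⟨L, h1, h2, h3⟩ := h
  refine ⟨s(x, y) ::ₘ L, isEdges_cons.2 ⟨hxy, hx, hy, h1⟩, by simp [h2], fun a => ?_⟩
  have h3 := h3 a
  have hz := hz a
  simp only [Finsupp.add_apply, edgesExp_cons] at h3 hz ⊢
  omega

theorem AltWalk.delete {P : Multiset (Sym2 V)} {u v : V} (h : AltWalk G A P u v)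
    (hP : IsEdges G A P) (w : V) :
    u ∈ exchangeable G A P w ∨ v ∈ exchangeable G A P w ∨
      EdgeDvd G (A \ {w}) ((edgesIn P (A \ {w})).card + 1)
        (edgesExp (edgesIn P (A \ {w})) + Finsupp.single u 1 + Finsupp.single v 1) := by
  have hw : ∀ {P}, IsEdges G A P → w ∈ exchangeable G A P w := fun {P} hP => ⟨P, hP, rfl, le_rfl⟩
  induction h with
  | @edge P x y hxy hx hy =>
    by_cases hxw : x = w
    · exact Or.inl (hxw ▸ hw hP)
    by_cases hyw : y = w
    · exact Or.inr (Or.inl (hyw ▸ hw hP))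
    · exact Or.inr (Or.inr ((edgeDvd_self (isEdges_edgesIn hP _)).cons hxy ⟨hx, hxw⟩ ⟨hy, hyw⟩
        (le_of_eq (by abel))))
  | symm _ ih =>
    rw [add_right_comm]
    have := ih hP
    tauto
  | @step P x y z v hxy hx hy hW ih =>
    have hP' := hP
    rw [isEdges_cons] at hP'
    obtain ⟨hyz, -, hz, hP1⟩ := hP'
    by_cases hxw : x = w
    · exact Or.inl (hxw ▸ hw hP)
    by_cases hyw : y = w
    · obtain ⟨L, h1, h2, h3⟩ := hW.edgeDvd hP1
      refine Or.inr (Or.inl ⟨L, h1, by simp [h2], fun a => ?_⟩)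
      have := h3 a
      subst hyw
      simp only [Finsupp.add_apply, edgesExp_cons] at this ⊢
      omega
    by_cases hzw : z = w
    · refine Or.inl (exchangeable_cons (z := w) (hw hP1) hxy hx hy (le_of_eq ?_))
      rw [edgesExp_cons, hzw]
      abel
    rcases ih hP1 with h | h | h
    · refine Or.inl (exchangeable_cons h hxy hx hy (le_of_eq ?_))
      rw [edgesExp_cons]
      abel
    · refine Or.inr (Or.inl ?_)
      rw [Sym2.eq_swap]
      refine exchangeable_cons h hyz hy hz (le_of_eq ?_)
      rw [edgesExp_cons]
      abel
    · refine Or.inr (Or.inr ?_)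
      rw [edgesIn_cons_of_mem (B := A \ {w}) ⟨hy, hyw⟩ ⟨hz, hzw⟩, Multiset.card_cons]
      refine h.cons hxy ⟨hx, hxw⟩ ⟨hy, hyw⟩ (le_of_eq ?_)
      rw [edgesExp_cons]
      abel

theorem AltWalk.delete_closedNbhd {P : Multiset (Sym2 V)} {u v w : V} (h : AltWalk G A P u v)
    (hP : IsEdges G A P) (hw : w ∈ A) :
    EdgeDvd G A (P.card + 1) (edgesExp P + Finsupp.single w 1 + Finsupp.single u 1) ∨
    EdgeDvd G A (P.card + 1) (edgesExp P + Finsupp.single w 1 + Finsupp.single v 1) ∨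
      EdgeDvd G (A \ closedNbhd G w) ((edgesIn P (A \ closedNbhd G w)).card + 1)
        (edgesExp (edgesIn P (A \ closedNbhd G w)) + Finsupp.single u 1 + Finsupp.single v 1) := by
  induction h with
  | @edge P x y hxy hx hy =>
    by_cases hxw : x ∈ closedNbhd G w
    · rcases hxw with rfl | hxw
      · exact Or.inr (Or.inl ((edgeDvd_self hP).cons hxy hx hy (le_of_eq (by abel))))
      · exact Or.inl ((edgeDvd_self hP).cons hxw hw hx (le_of_eq (by abel)))
    by_cases hyw : y ∈ closedNbhd G w
    · rcases hyw with rfl | hyw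
      · exact Or.inl ((edgeDvd_self hP).cons hxy hx hy (le_of_eq (by abel)))
      · exact Or.inr (Or.inl ((edgeDvd_self hP).cons hyw hw hy (le_of_eq (by abel))))
    · exact Or.inr (Or.inr ((edgeDvd_self (isEdges_edgesIn hP _)).cons hxy ⟨hx, hxw⟩ ⟨hy, hyw⟩
        (le_of_eq (by abel))))
  | symm _ ih =>
    rw [add_right_comm (edgesExp (edgesIn _ _))]
    have := ih hP
    tauto
  | @step P x y z v hxy hx hy hW ih =>
    have hP' := hP
    rw [isEdges_cons] at hP'
    obtain ⟨hyz, -, hz, hP1⟩ := hP'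
    rw [Multiset.card_cons, edgesExp_cons]
    have hN := hW.edgeDvd hP1
    by_cases hxw : x ∈ closedNbhd G w
    · rcases hxw with rfl | hxw
      · exact Or.inr (Or.inl (hN.cons hxy hx hy (le_of_eq (by abel))))
      · exact Or.inl (((edgeDvd_self hP1).cons hyz hy hz le_rfl).cons hxw hw hx
          (le_of_eq (by abel)))
    by_cases hzw : z ∈ closedNbhd G w
    · rcases hzw with rfl | hzw
      · exact Or.inr (Or.inl (hN.cons hyz hy hz (le_of_eq (by abel))))
      · exact Or.inl (((edgeDvd_self hP1).cons hxy hx hy le_rfl).cons hzw hw hz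
          (le_of_eq (by abel)))
    by_cases hyw : y ∈ closedNbhd G w
    · rcases hyw with rfl | hyw
      · exact (hzw (Or.inr hyz)).elim
      · exact Or.inr (Or.inl (hN.cons hyw hw hy (le_of_eq (by abel))))
    rcases ih hP1 with h | h | h
    · exact Or.inl (h.cons hxy hx hy (le_of_eq (by abel)))
    · exact Or.inr (Or.inl (h.cons hyz hy hz (le_of_eq (by abel))))
    · refine Or.inr (Or.inr ?_)
      rw [edgesIn_cons_of_mem (B := A \ closedNbhd G w) ⟨hy, hyw⟩ ⟨hz, hzw⟩, Multiset.card_cons]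
      refine h.cons hxy ⟨hx, hxw⟩ ⟨hy, hyw⟩ (le_of_eq ?_)
      rw [edgesExp_cons]
      abel

theorem single_le_of_add_le {m : V →₀ ℕ} {u v : V}
    (h : Finsupp.single u 1 + Finsupp.single v 1 ≤ m) :
    Finsupp.single u 1 ≤ m ∧ Finsupp.single v 1 ≤ m :=
  ⟨le_self_add.trans h, le_add_self.trans h⟩

theorem EdgeDvd.delete {P : Multiset (Sym2 V)} {m : V →₀ ℕ} (hP : IsEdges G A P) (w : V)
    (h : EdgeDvd G A (P.card + 1) (edgesExp P + m)) :
    (∃ y ∈ exchangeable G A P w, Finsupp.single y 1 ≤ m) ∨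
      EdgeDvd G (A \ {w}) ((edgesIn P (A \ {w})).card + 1) (edgesExp (edgesIn P (A \ {w})) + m) :=
        by
  obtain ⟨L, h1, h2, h3⟩ := h
  obtain ⟨u, v, hW, hm⟩ := exists_altWalk h1 h2 h3
  rcases hW.delete hP w with h | h | h
  · exact Or.inl ⟨u, h, (single_le_of_add_le hm).1⟩
  · exact Or.inl ⟨v, h, (single_le_of_add_le hm).2⟩
  · exact Or.inr (h.le (by rw [add_assoc]; gcongr))

theorem EdgeDvd.delete_closedNbhd {P : Multiset (Sym2 V)} {m : V →₀ ℕ} {w : V}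
    (hP : IsEdges G A P) (hw : w ∈ A)
    (h : EdgeDvd G A (P.card + 1) (edgesExp P + Finsupp.single w 1 + m)) :
    (∃ y, EdgeDvd G A (P.card + 1) (edgesExp P + Finsupp.single w 1 + Finsupp.single y 1) ∧
      Finsupp.single y 1 ≤ m) ∨
      EdgeDvd G (A \ closedNbhd G w) ((edgesIn P (A \ closedNbhd G w)).card + 1)
        (edgesExp (edgesIn P (A \ closedNbhd G w)) + m) := by
  obtain ⟨L, h1, h2, h3⟩ := h
  rw [add_assoc] at h3
  obtain ⟨u, v, hW, hm⟩ := exists_altWalk h1 h2 h3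
  have hN := hW.edgeDvd hP
  rcases eq_or_ne u w with rfl | hu
  · exact Or.inl ⟨v, hN, le_of_add_le_add_left hm⟩
  rcases eq_or_ne v w with rfl | hv
  · exact Or.inl ⟨u, hN.le (le_of_eq (by abel)), le_of_add_le_add_left (by rwa [add_comm] at hm)⟩
  have hm : Finsupp.single u 1 + Finsupp.single v 1 ≤ m :=
    le_of_le_add_single (by rwa [add_comm m]) (by simp [hu, hv])
  rcases hW.delete_closedNbhd hP hw with h | h | h
  · exact Or.inl ⟨u, h, (single_le_of_add_le hm).1⟩
  · exact Or.inl ⟨v, h, (single_le_of_add_le hm).2⟩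
  · exact Or.inr (h.le (by rw [add_assoc]; gcongr))

end Deletion

section Bound
variable {V : Type} {G : SimpleGraph V}

/-- Regularity bounds for induced subgraphs obtained by repeatedly splitting at a vertex, starting
from edgeless graphs. -/
inductive SplitBound (G : SimpleGraph V) : Set V → ℕ → Prop
  | edgeless {A : Set V} {r : ℕ} : (∀ u ∈ A, ∀ v ∈ A, ¬ G.Adj u v) → SplitBound G A (r + 1)
  | split {A : Set V} {w : V} {r : ℕ} : w ∈ A → SplitBound G (A \ {w}) (r + 2) →
      SplitBound G (A \ closedNbhd G w) (r + 1) → SplitBound G A (r + 2)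

theorem SplitBound.mono {A : Set V} {r r' : ℕ} (h : SplitBound G A r) (hr : r ≤ r') :
    SplitBound G A r' := by
  induction h generalizing r' with
  | edgeless h =>
    obtain ⟨r', rfl⟩ := Nat.exists_eq_add_of_le' (le_trans (Nat.le_add_left 1 _) hr)
    exact .edgeless h
  | split hw _ _ ih1 ih2 =>
    obtain ⟨r', rfl⟩ := Nat.exists_eq_add_of_le' (le_trans (Nat.le_add_left 2 _) hr)
    exact .split hw (ih1 hr) (ih2 (by omega))

theorem splitBound_of_finite {A : Set V} (hA : A.Finite) : ∃ r, SplitBound G A r := by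
  induction h : A.ncard using Nat.strong_induction_on generalizing A with
  | _ n ih =>
    rcases A.eq_empty_or_nonempty with rfl | ⟨w, hw⟩
    · exact ⟨1, .edgeless (by simp)⟩
    · subst h
      have h1 : A \ {w} ⊂ A := ⟨Set.sdiff_subset, fun h => (h hw).2 rfl⟩
      have h2 : A \ closedNbhd G w ⊂ A := ⟨Set.sdiff_subset, fun h => (h hw).2 (Or.inl rfl)⟩
      obtain ⟨r, hr⟩ := ih _ (Set.ncard_lt_ncard h1 hA) (hA.subset h1.1) rfl
      obtain ⟨r', hr'⟩ := ih _ (Set.ncard_lt_ncard h2 hA) (hA.subset h2.1) rfl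
      exact ⟨max r r' + 2, .split hw (hr.mono (by omega)) (hr'.mono (by omega))⟩

/-- The exponents of the colon ideal of the power of the edge ideal, with some variables added. -/
def edgeColon (G : SimpleGraph V) (A : Set V) (P : Multiset (Sym2 V)) (X : Set V) :
    Set (V →₀ ℕ) :=
  {m | (∃ v ∈ X, Finsupp.single v 1 ≤ m) ∨ EdgeDvd G A (P.card + 1) (edgesExp P + m)}

theorem isUpperSet_edgeColon (A : Set V) (P : Multiset (Sym2 V)) (X : Set V) :
    IsUpperSet (edgeColon G A P X) := by
  rintro m m' hm (⟨v, hv, h⟩ | h)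
  · exact Or.inl ⟨v, hv, h.trans hm⟩
  · exact Or.inr (h.le (by gcongr))

theorem edgeColon_exchangeable {A : Set V} {P : Multiset (Sym2 V)} (hP : IsEdges G A P) (w : V)
    (X : Set V) : edgeColon G A P (X ∪ exchangeable G A P w) =
      edgeColon G (A \ {w}) (edgesIn P (A \ {w})) (X ∪ exchangeable G A P w) := by
  ext m
  constructor
  · rintro (h | h)
    · exact Or.inl h
    · rcases h.delete hP w with ⟨y, hy, hm⟩ | h
      · exact Or.inl ⟨y, Or.inr hy, hm⟩
      · exact Or.inr h
  · rintro (h | h)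
    · exact Or.inl h
    · exact Or.inr (h.of_edgesIn hP Set.sdiff_subset)

theorem edgeColon_closedNbhd {A : Set V} {P : Multiset (Sym2 V)} (hP : IsEdges G A P) {w : V}
    (hw : w ∈ A) (X : Set V) :
    {m | (∃ v ∈ X, Finsupp.single v 1 ≤ m) ∨
      EdgeDvd G A (P.card + 1) (edgesExp P + Finsupp.single w 1 + m)} =
    edgeColon G (A \ closedNbhd G w) (edgesIn P (A \ closedNbhd G w))
      (X ∪ {y | EdgeDvd G A (P.card + 1)
        (edgesExp P + Finsupp.single w 1 + Finsupp.single y 1)}) := by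
  ext m
  constructor
  · rintro (⟨v, hv, h⟩ | h)
    · exact Or.inl ⟨v, Or.inl hv, h⟩
    · rcases h.delete_closedNbhd hP hw with ⟨y, hy, hm⟩ | h
      · exact Or.inl ⟨y, Or.inr hy, hm⟩
      · exact Or.inr h
  · rintro (⟨v, hv | hv, h⟩ | h)
    · exact Or.inl ⟨v, hv, h⟩
    · exact Or.inr (EdgeDvd.le hv (by gcongr))
    · refine Or.inr ((h.of_edgesIn hP Set.sdiff_subset).le ?_)
      rw [add_assoc]
      gcongr
      exact le_add_self

theorem single_le_single_add {v y : V} (h : v ≠ y) {m : V →₀ ℕ} :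
    Finsupp.single v 1 ≤ Finsupp.single y 1 + m ↔ Finsupp.single v 1 ≤ m := by
  classical
  simp [h]

theorem eq_of_le_of_degree_eq {a b : V →₀ ℕ} (h : a ≤ b) (hd : a.degree = b.degree) : a = b := by
  obtain ⟨c, rfl⟩ := exists_add_of_le h
  rw [map_add, left_eq_add, Finsupp.degree_eq_zero_iff] at hd
  rw [hd, add_zero]

variable {K : Type} [Field K] [Finite V]

theorem SplitBound.hasMonRes_edgeColon {A : Set V} {r : ℕ} (h : SplitBound G A r)
    {P : Multiset (Sym2 V)} (hP : IsEdges G A P) (X : Set V) :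
    HasMonRes K (edgeColon G A P X) r := by
  induction h generalizing P X with
  | edgeless h =>
    refine HasMonRes.mono ?_ (Nat.le_add_left 1 _)
    convert hasMonRes_vars (K := K) X using 1
    ext m
    refine or_iff_left ?_
    rintro ⟨L, h1, h2, -⟩
    obtain ⟨e, he⟩ := Multiset.card_pos_iff_exists_mem.1 (by omega : 0 < L.card)
    induction e using Sym2.ind with
    | _ a b => exact h a ((h1 _ he).2 a (by simp)) b ((h1 _ he).2 b (by simp)) (h1 _ he).1
  | @split A w r hw _ _ ih1 ih2 =>
    have hT : ∀ {P} (_ : IsEdges G A P) (X : Set V),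
        HasMonRes K {m | (∃ v ∈ X, Finsupp.single v 1 ≤ m) ∨
          EdgeDvd G A (P.card + 1) (edgesExp P + Finsupp.single w 1 + m)} (r + 1) :=
      fun {P} hP X => by
        rw [edgeColon_closedNbhd hP hw]
        exact ih2 (isEdges_edgesIn hP _) _
    have hE : HasMonRes K (edgeColon G A P (X ∪ exchangeable G A P w)) (r + 2) := by
      rw [edgeColon_exchangeable hP]
      exact ih1 (isEdges_edgesIn hP _) _
    have key : ∀ Y : Set V, Y.Finite → Y ⊆ exchangeable G A P w → ∀ X,
        HasMonRes K (edgeColon G A P (X ∪ Y)) (r + 2) →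
        HasMonRes K (edgeColon G A P X) (r + 2) := by
      intro Y hY
      induction Y, hY using Set.Finite.induction_on with
      | empty => simp
      | @insert y Y _ _ ih =>
        intro hYex X hX
        rw [Set.insert_subset_iff] at hYex
        by_cases hy : y ∈ X
        · refine ih hYex.2 X ?_
          rwa [Set.union_insert, Set.insert_eq_of_mem (Set.mem_union_left _ hy)] at hX
        have hX' := ih hYex.2 (insert y X) (by rwa [Set.insert_union, ← Set.union_insert])
        obtain ⟨L, hL, hLc, hLe⟩ := hYex.1
        have hLe := eq_of_le_of_degree_eq hLe (by simp [degree_edgesExp, hLc])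
        refine HasMonRes.of_or_of_colon (M := Finsupp.single y 1) (isUpperSet_edgeColon _ _ _)
          ?_ (r' := r + 1) ?_ (by simp)
        · convert hX' using 1
          ext m
          simp only [edgeColon, Set.mem_ofPred_eq, Set.exists_mem_insert]
          rw [or_right_comm, or_comm (a := ∃ _, _)]
        · convert hT hL X using 1
          ext m
          refine or_congr (exists_congr fun v => and_congr_right fun hv =>
            single_le_single_add fun h : v = y => hy (h ▸ hv)) ?_
          rw [hLe, hLc, add_assoc]
    exact key _ (Set.toFinite _) subset_rfl X hE

theorem SplitBound.hasMonRes_edgeDvd {A : Set V} {r : ℕ} (h : SplitBound G A r) (s : ℕ) :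
    HasMonRes K {m | EdgeDvd G A s m} (2 * s + r - 2) := by
  classical
  induction s with
  | zero =>
    convert hasMonRes_univ (K := K) (V := V) (2 * 0 + r - 2)
    ext m
    simpa using ⟨0, isEdges_zero, rfl, by simp⟩
  | succ s ih =>
    let : LinearOrder V := IsWellOrder.linearOrder WellOrderingRel
    let 𝓜 : Set (Lex (V →₀ ℕ)) := {M | ∃ P, IsEdges G A P ∧ P.card = s ∧ toLex (edgesExp P) = M}
    have hfin : 𝓜.Finite := by
      refine (Set.finite_range fun P : Sym (Sym2 V) s => toLex (edgesExp P.1)).subset ?_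
      rintro M ⟨P, -, hP, rfl⟩
      exact ⟨⟨P, hP⟩, rfl⟩
    have key : ∀ T : Finset (Lex (V →₀ ℕ)), ((∀ M ∈ T, M ∈ 𝓜) ∧
        ∀ M ∈ T, ∀ M' ∈ 𝓜, M' < M → M' ∈ T) →
        HasMonRes K {m | EdgeDvd G A (s + 1) m ∨ ∃ M ∈ T, ofLex M ≤ m} (2 * s + r) →
        HasMonRes K {m | EdgeDvd G A (s + 1) m} (2 * s + r) := by
      intro T
      induction T using Finset.induction_on_max with
      | empty => simp
      | insert a T ha ihT =>
        rintro ⟨hT1, hT2⟩ hres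
        have haT : ∀ M ∈ insert a T, M < a → M ∈ T := fun M hM hlt =>
          (Finset.mem_insert.1 hM).resolve_left hlt.ne
        refine ihT ⟨fun M hM => hT1 M (Finset.mem_insert_of_mem hM), fun M hM M' hM' hlt =>
          haT _ (hT2 M (Finset.mem_insert_of_mem hM) M' hM' hlt) (hlt.trans (ha M hM))⟩ ?_
        obtain ⟨P, hP, hPs, rfl⟩ := hT1 a (Finset.mem_insert_self _ _)
        refine HasMonRes.of_or_of_colon (M := edgesExp P) ?_ ?_ (r' := r) ?_
          (by rw [degree_edgesExp]; omega)
        · rintro m m' hm (h | ⟨M, hM, h⟩)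
          · exact Or.inl (h.le hm)
          · exact Or.inr ⟨M, hM, h.trans hm⟩
        · convert hres using 1
          ext m
          simp only [Set.mem_ofPred_eq, Finset.exists_mem_insert, ofLex_toLex]
          rw [or_assoc, or_comm (b := edgesExp P ≤ m)]
        · convert h.hasMonRes_edgeColon (K := K) hP
            {v | ∃ M ∈ T, ofLex M ≤ edgesExp P + Finsupp.single v 1} using 1
          ext m
          constructor
          · rintro (h | ⟨M, hM, hm⟩)
            · exact Or.inr (hPs ▸ h)
            obtain ⟨N, hN, hNs, rfl⟩ := hT1 M (Finset.mem_insert_of_mem hM)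
            have hlt := ha _ hM
            rcases exists_altWalk_or_halfWalks hN (hNs.trans hPs.symm) hm with
              ⟨u, v, hW, huv⟩ | ⟨l, h1, h2, h3⟩
            · refine Or.inr ((hW.edgeDvd hP).le ?_)
              rw [add_assoc]
              gcongr
            · left
              by_contra hcon
              have hle : ∀ p ∈ l, toLex (Finsupp.single p.2 1 : V →₀ ℕ) ≤
                  toLex (Finsupp.single p.1 1) := by
                intro p hp
                by_contra! hlt'
                obtain ⟨Q, hQ, hQs, hQe⟩ := (h1 p hp).exists_edges hP
                refine hcon ⟨p.1, ⟨toLex (edgesExp Q), haT _ (hT2 _ (Finset.mem_insert_self _ _) _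
                  ⟨Q, hQ, hQs.trans hPs, rfl⟩ ?_) ?_, ?_⟩, ?_⟩
                · have := congrArg toLex hQe
                  rw [toLex_add, toLex_add] at this
                  by_contra! hge
                  exact absurd this (add_lt_add_of_le_of_lt hge hlt').ne
                · have := congrArg toLex hQe
                  rw [toLex_add, toLex_add] at this
                  by_contra! hge
                  exact absurd this (add_lt_add_of_le_of_lt hge hlt').ne
                · rw [hQe]
                  exact le_self_add
                · exact (Multiset.single_le_sum (fun _ _ => zero_le) _
                    (Multiset.mem_map_of_mem (fun p : V × V => (Finsupp.single p.1 1 : V →₀ ℕ))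
                      hp)).trans h2
              have hsum : toLex (l.map fun p => (Finsupp.single p.2 1 : V →₀ ℕ)).sum ≤
                  toLex (l.map fun p => (Finsupp.single p.1 1 : V →₀ ℕ)).sum := by
                clear h1 h2 h3 hcon
                induction l using Multiset.induction_on with
                | empty => simp
                | cons p l ihl =>
                  rw [Multiset.map_cons, Multiset.map_cons, Multiset.sum_cons, Multiset.sum_cons,
                    toLex_add, toLex_add]
                  exact add_le_add (hle p (Multiset.mem_cons_self _ _))
                    (ihl fun q hq => hle q (Multiset.mem_cons_of_mem hq))
              have := congrArg toLex h3
              rw [toLex_add, toLex_add] at this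
              exact absurd this (add_lt_add_of_lt_of_le hlt hsum).ne'
          · rintro (⟨v, ⟨M, hM, h⟩, hv⟩ | h)
            · exact Or.inr ⟨M, hM, h.trans (by gcongr)⟩
            · exact Or.inl (hPs ▸ h)
    have := key hfin.toFinset ⟨by simp, by
      intro M _ M' h _
      simpa using h⟩ ?_
    · exact this.mono (by omega)
    · refine HasMonRes.mono ?_ (by omega : 2 * s + r - 2 ≤ _)
      convert ih using 1
      ext m
      constructor
      · rintro (h | ⟨M, hM, hm⟩)
        · exact h.of_le (Nat.le_succ s)
        · obtain ⟨P, h1, h2, rfl⟩ := hfin.mem_toFinset.1 hM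
          exact ⟨P, h1, h2, hm⟩
      · rintro ⟨P, h1, h2, h3⟩
        exact Or.inr ⟨toLex (edgesExp P), hfin.mem_toFinset.2 ⟨P, h1, h2, rfl⟩, h3⟩

end Bound

section Resolution
open MvPolynomial

/-- A graded free resolution of `M` with modules indexed by all natural numbers. -/
theorem HasFiniteRes.exists_resolution {S : Type} [CommRing S] {𝒮 : ℕ → AddSubgroup S}
    [SetLike.GradedMonoid 𝒮] {n : ℕ} {M : Type} [AddCommGroup M] [Module S M]
    {ℳ : ℕ → AddSubgroup M} {r : ℕ} (h : HasFiniteRes 𝒮 n M ℳ r) :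
    ∃ (m : ℕ → ℕ) (d : (i : ℕ) → Fin (m i) → ℕ)
      (f : (i : ℕ) → (Fin (m (i + 1)) → S) →ₗ[S] (Fin (m i) → S)) (ε : (Fin (m 0) → S) →ₗ[S] M),
      (∀ k, ε (Pi.single k 1) ∈ ℳ (d 0 k)) ∧
      (∀ i k, f i (Pi.single k 1) ∈ freeGr 𝒮 (d i) (d (i + 1) k)) ∧
      Function.Surjective ε ∧ LinearMap.range (f 0) = LinearMap.ker ε ∧
      (∀ i, LinearMap.range (f (i + 1)) = LinearMap.ker (f i)) ∧ ∀ i k, d i k ≤ i + r := by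
  induction n generalizing M r with
  | zero =>
    have : Subsingleton M := h
    exact ⟨fun _ => 0, fun _ _ => 0, fun _ => 0, 0, fun k => k.elim0, fun _ k => k.elim0,
      fun x => ⟨0, Subsingleton.elim _ _⟩, Subsingleton.elim _ _, fun _ => Subsingleton.elim _ _,
      fun _ k => k.elim0⟩
  | succ n ih =>
    obtain ⟨ι, _, d₀, π, hd, hπ, hgr, -, hker⟩ := h
    obtain ⟨m, d, f, ε, h1, h2, h3, h4, h5, h6⟩ := ih hker
    classical
    let φ := Fintype.equivFin ι
    let Φ : (Fin (Fintype.card ι) → S) ≃ₗ[S] (ι → S) := LinearEquiv.funCongrLeft S S φ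
    have hΦ (k) : Φ (Pi.single k 1) = Pi.single (φ.symm k) 1 := by
      ext l
      simp [Φ, LinearEquiv.funCongrLeft, LinearMap.funLeft, Pi.single_apply, Equiv.eq_symm_apply]
    let m' : ℕ → ℕ := fun i => Nat.casesOn i (Fintype.card ι) m
    let d' : (i : ℕ) → Fin (m' i) → ℕ := fun i =>
      match i with
      | 0 => fun k => d₀ (φ.symm k)
      | i + 1 => d i
    let f' : (i : ℕ) → (Fin (m' (i + 1)) → S) →ₗ[S] (Fin (m' i) → S) := fun i =>
      match i with
      | 0 => Φ.symm.toLinearMap ∘ₗ (LinearMap.ker π).subtype ∘ₗ ε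
      | i + 1 => f i
    refine ⟨m', d', f', π ∘ₗ Φ.toLinearMap, fun k => ?_, fun i k => ?_, ?_, ?_, fun i => ?_,
      fun i k => ?_⟩
    · exact hgr _ _ (by
        rw [LinearEquiv.coe_coe, hΦ]
        exact single_mem_freeGr d₀ _)
    · cases i with
      | zero =>
        intro l
        have := h1 k (φ.symm l)
        convert this using 1
        change Φ.symm _ l = _
        simp [Φ, LinearEquiv.funCongrLeft, LinearMap.funLeft]
      | succ i => exact h2 i k
    · exact hπ.comp Φ.surjective
    · ext x
      change x ∈ LinearMap.range (Φ.symm.toLinearMap ∘ₗ (LinearMap.ker π).subtype ∘ₗ ε) ↔ _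
      constructor
      · rintro ⟨y, rfl⟩
        simp
      · intro hx
        obtain ⟨y, hy⟩ := h3 ⟨Φ x, hx⟩
        exact ⟨y, by simp [hy]⟩
    · cases i with
      | zero =>
        change LinearMap.range (f 0) =
          LinearMap.ker (Φ.symm.toLinearMap ∘ₗ (LinearMap.ker π).subtype ∘ₗ ε)
        rw [h4, LinearEquiv.ker_comp, LinearMap.ker_comp, Submodule.ker_subtype]
        rfl
      | succ i => exact h5 i
    · cases i with
      | zero => simpa using hd _
      | succ i => exact (h6 i k).trans (by omega)

variable {K : Type} [Field K] {V : Type}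

theorem HasMonRes.hasResolutionDegreeBound {U : Set (V →₀ ℕ)} {hU : IsUpperSet U} {r : ℕ}
    (h : HasMonRes K U r) : HasResolutionDegreeBound K (monIdeal K U hU) r := by
  obtain ⟨_, n, h⟩ := h
  obtain ⟨m, d, f, ε, h1, h2, h3, h4, h5, h6⟩ := h.exists_resolution
  refine ⟨m, d, f, (monIdeal K U hU).subtype ∘ₗ ε, h1, fun i k l => ⟨?_, (h2 i k l).2⟩, ?_, ?_,
    h5, h6⟩
  · rcases le_or_gt (d i l) (d (i + 1) k) with hle | hlt
    · exact (h2 i k l).1 hle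
    · rw [(h2 i k l).2 hlt]
      exact isHomogeneous_zero _ _ _
  · rw [LinearMap.range_comp, LinearMap.range_eq_top.2 h3, Submodule.map_top,
      Submodule.range_subtype]
  · rw [h4, LinearMap.ker_comp, Submodule.ker_subtype]
    rfl

theorem HasResolutionDegreeBound.mono {I : Ideal (MvPolynomial V K)} {r r' : ℕ}
    (h : HasResolutionDegreeBound K I r) (hr : r ≤ r') : HasResolutionDegreeBound K I r' :=
  let ⟨m, d, f, ε, h1, h2, h3, h4, h5, h6⟩ := h
  ⟨m, d, f, ε, h1, h2, h3, h4, h5, fun i k => (h6 i k).trans (by omega)⟩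

theorem isUpperSet_edgeDvd (G : SimpleGraph V) (A : Set V) (s : ℕ) :
    IsUpperSet {m | EdgeDvd G A s m} := fun _ _ hm h => h.le hm

theorem monomial_edgesExp_mem {G : SimpleGraph V} {A : Set V} {P : Multiset (Sym2 V)}
    (hP : IsEdges G A P) : monomial (edgesExp P) (1 : K) ∈ edgeIdeal K G ^ P.card := by
  induction P using Multiset.induction_on with
  | empty => simp
  | cons e P ih =>
    induction e using Sym2.ind with
    | _ a b =>
      rw [isEdges_cons] at hP
      rw [Multiset.card_cons, pow_succ', edgesExp_cons,
        ← one_mul (1 : K), ← monomial_mul]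
      refine Ideal.mul_mem_mul (Ideal.subset_span ⟨a, b, hP.1, ?_⟩) (ih hP.2.2.2)
      rw [X, X, monomial_mul, one_mul]

theorem exists_adj_of_mem_edgeIdeal {G : SimpleGraph V} {f : MvPolynomial V K}
    (hf : f ∈ edgeIdeal K G) (b : V →₀ ℕ) (hb : f.coeff b ≠ 0) :
    ∃ u v, G.Adj u v ∧ Finsupp.single u 1 + Finsupp.single v 1 ≤ b := by
  classical
  have hU : IsUpperSet {b : V →₀ ℕ | ∃ u v, G.Adj u v ∧
      Finsupp.single u 1 + Finsupp.single v 1 ≤ b} :=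
    fun _ _ hm ⟨u, v, h, h'⟩ => ⟨u, v, h, h'.trans hm⟩
  suffices edgeIdeal K G ≤ monIdeal K _ hU from this hf b hb
  refine Ideal.span_le.2 ?_
  rintro _ ⟨u, v, huv, rfl⟩ b hb
  rw [X, X, monomial_mul, coeff_monomial, ite_ne_right_iff] at hb
  exact ⟨u, v, huv, hb.1.le⟩

theorem edgeIdeal_pow_eq (G : SimpleGraph V) (s : ℕ) :
    edgeIdeal K G ^ s = monIdeal K {m | EdgeDvd G Set.univ s m} (isUpperSet_edgeDvd G _ s) := by
  classical
  apply le_antisymm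
  · induction s with
    | zero => exact fun f _ b _ => ⟨0, isEdges_zero, rfl, by simp⟩
    | succ s ih =>
      rw [pow_succ', Ideal.mul_le]
      intro f hf g hg b hb
      rw [coeff_mul] at hb
      obtain ⟨⟨x, y⟩, hxy, h⟩ := Finset.exists_ne_zero_of_sum_ne_zero hb
      rw [Finset.HasAntidiagonal.mem_antidiagonal] at hxy
      obtain ⟨u, v, huv, hle⟩ := exists_adj_of_mem_edgeIdeal hf x (left_ne_zero_of_mul h)
      refine EdgeDvd.cons (ih hg y (right_ne_zero_of_mul h)) huv trivial trivial ?_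
      rw [← hxy]
      gcongr
  · intro f hf
    rw [f.as_sum]
    refine Ideal.sum_mem _ fun b hb => ?_
    obtain ⟨P, hP, rfl, hle⟩ := hf b (mem_support_iff.1 hb)
    obtain ⟨c, rfl⟩ := exists_add_of_le hle
    rw [add_comm, ← mul_one (coeff _ f), ← monomial_mul]
    exact Ideal.mul_mem_left _ _ (monomial_edgesExp_mem hP)

theorem SplitBound.hasResolutionDegreeBound [Finite V] {G : SimpleGraph V} {r : ℕ}
    (h : SplitBound G Set.univ r) (s : ℕ) :
    HasResolutionDegreeBound K (edgeIdeal K G ^ s) (2 * s + r - 2) := by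
  rw [edgeIdeal_pow_eq]
  exact (h.hasMonRes_edgeDvd s).hasResolutionDegreeBound

end Resolution

section Koszul
open MvPolynomial AlternatingMap
variable {K : Type} [Field K] {V : Type} [Fintype V] [DecidableEq V]
  {N : Type} [AddCommGroup N] [Module K N] [Module (MvPolynomial V K) N]
  [IsScalarTower K (MvPolynomial V K) N]

/-- Contraction of an alternating map with a standard basis vector. -/
noncomputable def contr (K : Type) [Field K] {V : Type} [Fintype V] [DecidableEq V]
    {N : Type} [AddCommGroup N] [Module K N] [Module (MvPolynomial V K) N]
    [IsScalarTower K (MvPolynomial V K) N] {p : ℕ} (v : V) :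
    ((V → K) [⋀^Fin (p + 1)]→ₗ[K] N) →ₗ[MvPolynomial V K] ((V → K) [⋀^Fin p]→ₗ[K] N) where
  toFun z := z.curryLeft (Pi.single v 1)
  map_add' _ _ := rfl
  map_smul' _ _ := rfl

theorem contr_apply {p : ℕ} (v : V) (z : (V → K) [⋀^Fin (p + 1)]→ₗ[K] N) (t : Fin p → V → K) :
    contr K v z t = z (Matrix.vecCons (Pi.single v 1) t) := rfl

theorem contr_contr_self {p : ℕ} (v : V) (z : (V → K) [⋀^Fin (p + 2)]→ₗ[K] N) :
    contr K v (contr K v z) = 0 := curryLeft_same z _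

theorem contr_contr {p : ℕ} (u v : V) (z : (V → K) [⋀^Fin (p + 2)]→ₗ[K] N) :
    contr K u (contr K v z) = - contr K v (contr K u z) := by
  have h := curryLeft_same z (Pi.single u 1 + Pi.single v 1)
  have hu := contr_contr_self u z
  have hv := contr_contr_self v z
  simp only [map_add, curryLeft_add, LinearMap.add_apply] at h
  rw [eq_neg_iff_add_eq_zero]
  change (contr K u (contr K u z) + contr K u (contr K v z)) +
    (contr K v (contr K u z) + contr K v (contr K v z)) = 0 at h
  rw [hu, hv, zero_add, add_zero] at h
  exact h

theorem eq_zero_of_contr {p : ℕ} {z : (V → K) [⋀^Fin (p + 1)]→ₗ[K] N}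
    (h : ∀ v, contr K v z = 0) : z = 0 := by
  refine Module.Basis.ext_alternating (Pi.basisFun K V) fun v _ => ?_
  have := congrFun (congrArg DFunLike.coe (h (v 0))) fun i => Pi.single (v i.succ) 1
  rw [contr_apply, AlternatingMap.zero_apply] at this
  rw [AlternatingMap.zero_apply]
  convert this using 2
  ext i : 1
  cases i using Fin.cases <;> simp

/-- The Koszul differential. -/
noncomputable def koszul (K : Type) [Field K] {V : Type} [Fintype V] [DecidableEq V]
    {N : Type} [AddCommGroup N] [Module K N] [Module (MvPolynomial V K) N]
    [IsScalarTower K (MvPolynomial V K) N] {p : ℕ} :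
    ((V → K) [⋀^Fin (p + 1)]→ₗ[K] N) →ₗ[MvPolynomial V K] ((V → K) [⋀^Fin p]→ₗ[K] N) :=
  ∑ v : V, (X v : MvPolynomial V K) • contr K v

theorem koszul_eq {p : ℕ} (z : (V → K) [⋀^Fin (p + 1)]→ₗ[K] N) :
    koszul K z = ∑ v : V, (X v : MvPolynomial V K) • contr K v z := by
  simp [koszul]

theorem koszul_apply {p : ℕ} (z : (V → K) [⋀^Fin (p + 1)]→ₗ[K] N) (t : Fin p → V → K) :
    koszul K z t = ∑ v : V, (X v : MvPolynomial V K) • z (Matrix.vecCons (Pi.single v 1) t) := by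
  rw [koszul_eq]
  exact map_sum (⟨⟨fun y => y t, rfl⟩, fun _ _ => rfl⟩ : ((V → K) [⋀^Fin p]→ₗ[K] N) →+ N) _ _

theorem koszul_koszul {p : ℕ} (z : (V → K) [⋀^Fin (p + 2)]→ₗ[K] N) :
    koszul K (koszul K z) = 0 := by
  simp only [koszul_eq, map_sum, map_smul, Finset.smul_sum]
  rw [← Finset.sum_product']
  refine Finset.sum_involution (fun a _ => (a.2, a.1)) ?_ ?_ (by simp) (by simp)
  · rintro ⟨u, v⟩ -
    simp only
    rw [contr_contr, smul_neg, smul_neg, smul_comm]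
    exact neg_add_cancel _
  · rintro ⟨u, v⟩ - h huv
    obtain rfl : v = u := congrArg Prod.fst huv
    simp [contr_contr_self] at h

theorem koszul_comp {N' : Type} [AddCommGroup N'] [Module K N'] [Module (MvPolynomial V K) N']
    [IsScalarTower K (MvPolynomial V K) N'] (ε : N →ₗ[MvPolynomial V K] N') {p : ℕ}
    (z : (V → K) [⋀^Fin (p + 1)]→ₗ[K] N) :
    koszul K ((ε.restrictScalars K).compAlternatingMap z) =
      (ε.restrictScalars K).compAlternatingMap (koszul K z) := by
  ext t
  simp [koszul_apply]

/-- Exterior multiplication by a coordinate form. -/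
noncomputable def wedge (K : Type) [Field K] {V : Type} [Fintype V] [DecidableEq V]
    {N : Type} [AddCommGroup N] [Module K N] [Module (MvPolynomial V K) N]
    [IsScalarTower K (MvPolynomial V K) N] {p : ℕ} (w : V) :
    ((V → K) [⋀^Fin p]→ₗ[K] N) →ₗ[MvPolynomial V K] ((V → K) [⋀^Fin (p + 1)]→ₗ[K] N) where
  toFun z := alternatizeUncurryFin ((LinearMap.proj w).smulRight z)
  map_add' _ _ := by
    ext
    simp [alternatizeUncurryFin_apply, Finset.sum_add_distrib]
  map_smul' _ _ := by
    ext
    simp only [alternatizeUncurryFin_apply, AlternatingMap.smul_apply, Finset.smul_sum,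
      LinearMap.smulRight_apply, RingHom.id_apply]
    exact Finset.sum_congr rfl fun i _ => by rw [smul_comm _ (_ : MvPolynomial V K),
      smul_comm _ (_ : MvPolynomial V K)]

theorem wedge_apply {p : ℕ} (w : V) (z : (V → K) [⋀^Fin p]→ₗ[K] N) (t : Fin (p + 1) → V → K) :
    wedge K w z t = ∑ i : Fin (p + 1), (-1) ^ (i : ℕ) • (t i w • z (i.removeNth t)) := by
  simp [wedge, alternatizeUncurryFin_apply]

theorem contr_wedge {p : ℕ} (v w : V) (z : (V → K) [⋀^Fin (p + 1)]→ₗ[K] N) :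
    contr K v (wedge K w z) = (Pi.single v 1 : V → K) w • z - wedge K w (contr K v z) := by
  ext t
  rw [contr_apply, wedge_apply, Fin.sum_univ_succ, AlternatingMap.sub_apply, wedge_apply,
    sub_eq_add_neg, ← Finset.sum_neg_distrib]
  congr 1
  · simp [Matrix.vecCons]
  · refine Finset.sum_congr rfl fun i _ => ?_
    have : i.succ.removeNth (Matrix.vecCons (Pi.single v 1) t) =
        Matrix.vecCons (Pi.single v (1 : K)) (i.removeNth t) := by
      ext j : 1
      cases j using Fin.cases <;> simp [Fin.removeNth, Matrix.vecCons]
    rw [this, contr_apply]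
    simp [pow_succ]

theorem contr_wedge_zero (v w : V) (z : (V → K) [⋀^Fin 0]→ₗ[K] N) :
    contr K v (wedge K w z) = (Pi.single v 1 : V → K) w • z := by
  ext t
  rw [contr_apply, wedge_apply, Fin.sum_univ_one, Subsingleton.elim (Fin.removeNth _ _) t]
  simp

theorem koszul_wedge {p : ℕ} (w : V) (z : (V → K) [⋀^Fin (p + 1)]→ₗ[K] N) :
    koszul K (wedge K w z) = (X w : MvPolynomial V K) • z - wedge K w (koszul K z) := by
  simp only [koszul_eq, contr_wedge, smul_sub, Finset.sum_sub_distrib, map_sum, map_smul]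
  congr 1
  rw [Finset.sum_eq_single w (by intro b _ h; simp [h]) (by simp)]
  simp

/-- Division by a variable, as a linear map. -/
noncomputable def divX (K : Type) [Field K] {V : Type} (w : V) :
    MvPolynomial V K →ₗ[K] MvPolynomial V K where
  toFun f := f.divMonomial (Finsupp.single w 1)
  map_add' _ _ := add_divMonomial _ _ _
  map_smul' _ _ := by
    ext
    simp [coeff_divMonomial]

/-- Substituting zero for a variable, as a linear map. -/
noncomputable def modX (K : Type) [Field K] {V : Type} (w : V) :
    MvPolynomial V K →ₗ[K] MvPolynomial V K :=
  LinearMap.id - (LinearMap.mulLeft K (X w)).comp (divX K w)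

theorem X_mul_divX {V : Type} [DecidableEq V] (v w : V) (f : MvPolynomial V K) :
    X v * divX K w f = divX K w (X v * f) - (Pi.single v 1 : V → K) w • modX K w f := by
  rcases eq_or_ne v w with rfl | h
  · simp [divX, modX, X_mul_divMonomial]
  · rw [Pi.single_eq_of_ne' h, zero_smul, sub_zero]
    ext b
    simp only [divX, LinearMap.coe_mk, AddHom.coe_mk, coeff_divMonomial, coeff_X_mul']
    simp only [Finsupp.mem_support_iff, Finsupp.add_apply, Finsupp.single_apply, h.symm, if_false,
      zero_add]
    split_ifs with hb
    · rw [add_tsub_assoc_of_le]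
      rw [Finsupp.single_le_iff]
      omega
    · rfl

theorem koszul_divX {p : ℕ} (w : V) (z : (V → K) [⋀^Fin (p + 1)]→ₗ[K] MvPolynomial V K) :
    koszul K ((divX K w).compAlternatingMap z) = (divX K w).compAlternatingMap (koszul K z) -
      (modX K w).compAlternatingMap (contr K w z) := by
  ext t : 1
  simp only [koszul_apply, LinearMap.compAlternatingMap_apply, AlternatingMap.sub_apply,
    contr_apply,
    smul_eq_mul, X_mul_divX, Finset.sum_sub_distrib, map_sum]
  congr 1
  rw [Finset.sum_eq_single w (by intro b _ h; simp [h]) (by simp)]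
  simp

theorem koszul_homotopy {p : ℕ} (w : V) {z : (V → K) [⋀^Fin (p + 1)]→ₗ[K] MvPolynomial V K}
    (hz : koszul K z = 0) :
    z - koszul K (wedge K w ((divX K w).compAlternatingMap z)) =
      (modX K w).compAlternatingMap z - wedge K w ((modX K w).compAlternatingMap (contr K w z)) :=
        by
  rw [koszul_wedge, koszul_divX, hz, LinearMap.compAlternatingMap_zero, zero_sub, map_neg,
    sub_neg_eq_add, ← sub_sub]
  congr 1

theorem contr_mod_sub_wedge {p : ℕ} (w : V) (z : (V → K) [⋀^Fin (p + 1)]→ₗ[K] MvPolynomial V K)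
    {v : V} (hv : v = w ∨ contr K v z = 0) :
    contr K v ((modX K w).compAlternatingMap z -
      wedge K w ((modX K w).compAlternatingMap (contr K w z))) = 0 := by
  have hc (q : ℕ) (v : V) (y : (V → K) [⋀^Fin (q + 1)]→ₗ[K] MvPolynomial V K) :
      contr K v ((modX K w).compAlternatingMap y) =
        (modX K w).compAlternatingMap (contr K v y) := rfl
  have h0 : (modX K w).compAlternatingMap (contr K v z) -
      (Pi.single v 1 : V → K) w • (modX K w).compAlternatingMap (contr K w z) = 0 := by
    by_cases h : v = w
    · subst h
      simp
    · simp [hv.resolve_left h, Ne.symm h]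
  rw [map_sub, hc]
  cases p with
  | zero => rw [contr_wedge_zero, h0]
  | succ p =>
    rw [contr_wedge, ← sub_add, h0, zero_add, hc]
    rcases hv with rfl | hv
    · rw [contr_contr_self]
      simp
    · rw [contr_contr, hv]
      simp

/-- The Koszul complex of a polynomial ring is exact in positive degrees. -/
theorem exists_koszul_eq {p : ℕ} {z : (V → K) [⋀^Fin (p + 1)]→ₗ[K] MvPolynomial V K}
    (hz : koszul K z = 0) : ∃ u, koszul K u = z := by
  suffices ∀ T : Finset V, ∃ u, ∀ v ∈ T, contr K v (z - koszul K u) = 0 by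
    obtain ⟨u, hu⟩ := this Finset.univ
    exact ⟨u, (sub_eq_zero.1 (eq_zero_of_contr fun v => hu v (Finset.mem_univ _))).symm⟩
  intro T
  induction T using Finset.induction_on with
  | empty => exact ⟨0, by simp⟩
  | insert w T _ ih =>
    obtain ⟨u, hu⟩ := ih
    refine ⟨u + wedge K w ((divX K w).compAlternatingMap (z - koszul K u)), fun v hv => ?_⟩
    rw [map_add, ← sub_sub, koszul_homotopy w (by rw [map_sub, hz, koszul_koszul, sub_zero])]
    exact contr_mod_sub_wedge w _ ((Finset.mem_insert.1 hv).imp_right (hu v))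

theorem exists_koszul_eq_pi {κ : Type} {p : ℕ}
    {z : (V → K) [⋀^Fin (p + 1)]→ₗ[K] (κ → MvPolynomial V K)}
    (hz : koszul K z = 0) : ∃ u, koszul K u = z := by
  have h (k : κ) : ∃ u, koszul K u =
      ((LinearMap.proj k : (κ → MvPolynomial V K) →ₗ[MvPolynomial V K] _).restrictScalars
        K).compAlternatingMap z :=
    exists_koszul_eq (by rw [koszul_comp, hz, LinearMap.compAlternatingMap_zero])
  choose u hu using h
  refine ⟨AlternatingMap.pi u, ?_⟩
  ext t k : 2
  have := congrFun (congrArg DFunLike.coe (hu k)) t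
  simp only [LinearMap.compAlternatingMap_apply, LinearMap.restrictScalars_apply,
    LinearMap.proj_apply] at this
  rw [← this, koszul_apply, koszul_apply, Finset.sum_apply]
  rfl

end Koszul

section Linear
open MvPolynomial
variable {K : Type} [Field K] {V : Type}

/-- The projection of a graded free module to its degree `e` part. -/
noncomputable def freeProj (K : Type) [Field K] (V : Type) {ι : Type} (d : ι → ℕ) (e : ℕ) :
    (ι → MvPolynomial V K) →ₗ[K] (ι → MvPolynomial V K) :=
  LinearMap.pi fun l =>
    if d l ≤ e then (homogeneousComponent (e - d l)).comp (LinearMap.proj l) else 0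

theorem freeProj_apply {ι : Type} (d : ι → ℕ) (e : ℕ) (x : ι → MvPolynomial V K) (l : ι) :
    freeProj K V d e x l = if d l ≤ e then homogeneousComponent (e - d l) (x l) else 0 := by
  simp only [freeProj, LinearMap.pi_apply]
  split_ifs <;> rfl

theorem freeProj_mem {ι : Type} (d : ι → ℕ) (e : ℕ) (x : ι → MvPolynomial V K) :
    freeProj K V d e x ∈ freeGr (homGr K V) d e := by
  intro l
  rw [freeProj_apply]
  refine ⟨fun h => ?_, fun h => if_neg (by omega)⟩
  rw [if_pos h]
  exact homogeneousComponent_isHomogeneous _ _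

theorem freeProj_of_mem {ι : Type} {d : ι → ℕ} {e e' : ℕ} {x : ι → MvPolynomial V K}
    (hx : x ∈ freeGr (homGr K V) d e') : freeProj K V d e x = if e' = e then x else 0 := by
  ext1 l
  rw [freeProj_apply]
  rcases le_or_gt (d l) e' with h | h
  · have := (hx l).1 h
    split_ifs with h1 h2 h2
    · subst h2
      exact (homogeneousComponent_of_mem this).trans (if_pos rfl)
    · exact (homogeneousComponent_of_mem this).trans (if_neg (by omega))
    · omega
    · rfl
  · rw [(hx l).2 h, map_zero, ite_self]
    split_ifs
    · exact ((hx l).2 h).symm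
    · rfl

theorem single_mem_freeGr_add {ι : Type} [DecidableEq ι] (d : ι → ℕ) (k : ι) {j : ℕ}
    {a : MvPolynomial V K} (ha : a.IsHomogeneous j) :
    Pi.single k a ∈ freeGr (homGr K V) d (j + d k) := by
  have := gradedSMulFamily_free (𝒮 := homGr K V) d (show a ∈ homGr K V j from ha)
    (single_mem_freeGr d k)
  rwa [← Pi.single_smul', smul_eq_mul, mul_one] at this

theorem map_freeProj {N : Type} [AddCommGroup N] [Module K N] [Module (MvPolynomial V K) N]
    {ι : Type} [Fintype ι] {d : ι → ℕ} {e : ℕ}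
    {φ : (ι → MvPolynomial V K) →ₗ[MvPolynomial V K] N} {P : N →ₗ[K] N}
    (hP : ∀ e', ∀ x ∈ freeGr (homGr K V) d e', P (φ x) = if e' = e then φ x else 0)
    (x : ι → MvPolynomial V K) : φ (freeProj K V d e x) = P (φ x) := by
  classical
  have h1 : ∀ e', ∀ x ∈ freeGr (homGr K V) d e', φ (freeProj K V d e x) = P (φ x) := by
    intro e' x hx
    rw [hP e' x hx, freeProj_of_mem hx]
    split_ifs
    · rfl
    · exact map_zero _
  have hx : x = ∑ k, ∑ j ∈ Finset.range ((x k).totalDegree + 1),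
      Pi.single k (homogeneousComponent j (x k)) := by
    ext1 l
    rw [Finset.sum_apply, Finset.sum_eq_single l]
    · simp [sum_homogeneousComponent]
    · intro k _ hk
      simp [Pi.single_eq_of_ne' hk]
    · simp
  rw [hx]
  simp only [map_sum]
  exact Finset.sum_congr rfl fun k _ => Finset.sum_congr rfl fun j _ => h1 _ _
    (single_mem_freeGr_add d k (homogeneousComponent_isHomogeneous _ _))

variable {N : Type} [AddCommGroup N] [Module K N] [Module (MvPolynomial V K) N]
  [IsScalarTower K (MvPolynomial V K) N]

theorem exists_alternating_lift {ι : Type} [Fintype ι] {d : ι → ℕ} {e p : ℕ}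
    {φ : (ι → MvPolynomial V K) →ₗ[MvPolynomial V K] N} {P : N →ₗ[K] N}
    (hP : ∀ e', ∀ x ∈ freeGr (homGr K V) d e', P (φ x) = if e' = e then φ x else 0)
    {y : (V → K) [⋀^Fin p]→ₗ[K] N} (hy : ∀ t, y t ∈ LinearMap.range φ) (hPy : ∀ t, P (y t) = y t) :
    ∃ y' : (V → K) [⋀^Fin p]→ₗ[K] (ι → MvPolynomial V K),
      (∀ t, y' t ∈ freeGr (homGr K V) d e) ∧ (φ.restrictScalars K).compAlternatingMap y' = y := by
  obtain ⟨g, hg⟩ := (φ.restrictScalars K).rangeRestrict.exists_rightInverse_of_surjective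
    (LinearMap.range_rangeRestrict _)
  refine ⟨((freeProj K V d e).comp g).compAlternatingMap (y.codRestrict _ hy),
    fun t => freeProj_mem _ _ _, ?_⟩
  ext t
  have h : φ (g ⟨y t, hy t⟩) = y t :=
    congrArg Subtype.val (LinearMap.congr_fun hg ⟨y t, hy t⟩)
  exact (map_freeProj hP _).trans ((congrArg P h).trans (hPy t))

/-- A complex of graded free modules, exact also at the first module, whose `i`-th module is
generated in degrees at most `i + r`. -/
structure IsLinearRes {m : ℕ → ℕ} (d : (i : ℕ) → Fin (m i) → ℕ)
    (f : (i : ℕ) → (Fin (m (i + 1)) → MvPolynomial V K) →ₗ[MvPolynomial V K]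
      (Fin (m i) → MvPolynomial V K))
    (ε : (Fin (m 0) → MvPolynomial V K) →ₗ[MvPolynomial V K] N) (r : ℕ) : Prop where
  graded : ∀ i k, f i (Pi.single k 1) ∈ freeGr (homGr K V) (d i) (d (i + 1) k)
  range_zero : LinearMap.range (f 0) = LinearMap.ker ε
  range_succ : ∀ i, LinearMap.range (f (i + 1)) = LinearMap.ker (f i)
  le : ∀ i k, d i k ≤ i + r

theorem map_mem_of_map_single {N : Type} [AddCommGroup N] [Module (MvPolynomial V K) N]
    {ι : Type} [Fintype ι] [DecidableEq ι] {d : ι → ℕ}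
    {φ : (ι → MvPolynomial V K) →ₗ[MvPolynomial V K] N} {𝒩 : ℕ → AddSubgroup N}
    (h𝒩 : GradedSMulFamily (homGr K V) 𝒩) (h : ∀ k, φ (Pi.single k 1) ∈ 𝒩 (d k)) {e : ℕ}
    {x : ι → MvPolynomial V K} (hx : x ∈ freeGr (homGr K V) d e) : φ x ∈ 𝒩 e := by
  have : φ x = ∑ k, x k • φ (Pi.single k 1) := by
    simp_rw [← map_smul, ← map_sum]
    exact congrArg φ (pi_eq_sum_univ' x)
  rw [this]
  exact sum_smul_mem h𝒩 h hx

theorem exists_eq_sum_X_mul [Fintype V] {a : MvPolynomial V K} (ha : a.coeff 0 = 0) :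
    ∃ b : V → MvPolynomial V K, ∑ v, X v * b v = a := by
  classical
  have : a ∈ Ideal.span (Set.range (X : V → MvPolynomial V K)) := by
    rw [← Set.image_univ, mem_ideal_span_X_image]
    intro m hm
    by_contra! h
    refine mem_support_iff.1 hm ?_
    have : m = 0 := Finsupp.ext fun v => h v trivial
    rw [this, ha]
  obtain ⟨b, hb⟩ := (Ideal.mem_span_range_iff_exists_fun).1 this
  exact ⟨b, by rw [← hb]; simp [mul_comm]⟩

theorem IsLinearRes.apply_zero {N : Type} [AddCommGroup N] [Module (MvPolynomial V K) N]
    {m : ℕ → ℕ} {d : (i : ℕ) → Fin (m i) → ℕ}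
    {f : (i : ℕ) → (Fin (m (i + 1)) → MvPolynomial V K) →ₗ[MvPolynomial V K]
      (Fin (m i) → MvPolynomial V K)}
    {ε : (Fin (m 0) → MvPolynomial V K) →ₗ[MvPolynomial V K] N} {r : ℕ}
    (h : IsLinearRes d f ε r) (x : Fin (m 1) → MvPolynomial V K) : ε (f 0 x) = 0 :=
  h.range_zero.le (LinearMap.mem_range_self _ x)

theorem freeProj_map {ι κ : Type} [Fintype ι] [DecidableEq ι] {d : ι → ℕ} {d' : κ → ℕ}
    {φ : (ι → MvPolynomial V K) →ₗ[MvPolynomial V K] (κ → MvPolynomial V K)}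
    (hφ : ∀ k, φ (Pi.single k 1) ∈ freeGr (homGr K V) d' (d k)) (e e' : ℕ)
    (x : ι → MvPolynomial V K) (hx : x ∈ freeGr (homGr K V) d e') :
    freeProj K V d' e (φ x) = if e' = e then φ x else 0 :=
  freeProj_of_mem (map_mem_of_map_single (gradedSMulFamily_free d') hφ hx)

variable [Fintype V] [DecidableEq V]

/-- Koszul cycles, where everything is a cycle in degree zero. -/
def KoszulCycle : ∀ {p : ℕ}, ((V → K) [⋀^Fin p]→ₗ[K] N) → Prop
  | 0, _ => True
  | _ + 1, z => koszul K z = 0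

theorem koszulCycle_koszul {p : ℕ} (z : (V → K) [⋀^Fin (p + 1)]→ₗ[K] N) :
    KoszulCycle (koszul K z) := by
  cases p with
  | zero => trivial
  | succ p => exact koszul_koszul z

theorem koszul_wedge_zero (w : V) (z : (V → K) [⋀^Fin 0]→ₗ[K] N) :
    koszul K (wedge K w z) = (X w : MvPolynomial V K) • z := by
  simp only [koszul_eq, contr_wedge_zero]
  rw [Finset.sum_eq_single w (by intro b _ h; simp [h]) (by simp)]
  simp

theorem exists_koszul_eq_of_coeff_zero {κ : Type}
    {y : (V → K) [⋀^Fin 0]→ₗ[K] (κ → MvPolynomial V K)}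
    (hy : ∀ t k, (y t k).coeff 0 = 0) : ∃ x, koszul K x = y := by
  choose b hb using fun k => exists_eq_sum_X_mul (hy 0 k)
  refine ⟨∑ v, wedge K v (AlternatingMap.constOfIsEmpty K (V → K) (Fin 0) fun k => b k v), ?_⟩
  rw [map_sum]
  simp only [koszul_wedge_zero]
  ext t k : 2
  rw [Subsingleton.elim t 0, ← hb]
  refine (congrFun (map_sum (⟨⟨fun y => y 0, rfl⟩, fun _ _ => rfl⟩ :
    ((V → K) [⋀^Fin 0]→ₗ[K] (κ → MvPolynomial V K)) →+ _) _ _) k).trans ?_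
  rw [Finset.sum_apply]
  rfl

/-- Koszul cycles of high degree in the image of a linear resolution are boundaries. -/
theorem IsLinearRes.exists_koszul_eq {m : ℕ → ℕ} {d : (i : ℕ) → Fin (m i) → ℕ}
    {f : (i : ℕ) → (Fin (m (i + 1)) → MvPolynomial V K) →ₗ[MvPolynomial V K]
      (Fin (m i) → MvPolynomial V K)}
    {ε : (Fin (m 0) → MvPolynomial V K) →ₗ[MvPolynomial V K] N} {r : ℕ}
    (h : IsLinearRes d f ε r) {p e : ℕ} (he : r < e)
    {y : (V → K) [⋀^Fin p]→ₗ[K] (Fin (m 0) → MvPolynomial V K)}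
    (hy : ∀ t, y t ∈ freeGr (homGr K V) (d 0) e)
    (hcyc : KoszulCycle ((ε.restrictScalars K).compAlternatingMap y)) :
    ∃ x, (ε.restrictScalars K).compAlternatingMap y =
      koszul K ((ε.restrictScalars K).compAlternatingMap x) := by
  induction p generalizing m N r e with
  | zero =>
    obtain ⟨x, rfl⟩ := exists_koszul_eq_of_coeff_zero (y := y) fun t k => by
      have hk := (h.le 0 k).trans_lt (by omega : 0 + r < e)
      exact ((hy t k).1 hk.le).coeff_eq_zero (by simp; omega)
    exact ⟨x, (koszul_comp ε x).symm⟩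
  | succ p ih =>
    have hε : (ε.restrictScalars K).compAlternatingMap (koszul K y) = 0 := by
      rw [← koszul_comp]
      exact hcyc
    have hdeg : ∀ t, koszul K y t ∈ freeGr (homGr K V) (d 0) (e + 1) := by
      intro t
      rw [koszul_apply]
      refine sum_mem fun v _ => ?_
      rw [add_comm]
      exact gradedSMulFamily_free (d 0) (isHomogeneous_X K v) (hy _)
    obtain ⟨y', hy', hyy'⟩ := exists_alternating_lift (y := koszul K y) (e := e + 1)
      (fun e' => freeProj_map (h.graded 0) (e + 1) e')
      (fun t => h.range_zero.ge (congrFun (congrArg DFunLike.coe hε) t))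
      (fun t => by rw [freeProj_of_mem (hdeg t), if_pos rfl])
    obtain ⟨x, hx⟩ := ih (m := fun i => m (i + 1)) (d := fun i => d (i + 1))
      (f := fun i => f (i + 1)) (ε := f 0) (r := r + 1)
      ⟨fun i => h.graded (i + 1), h.range_succ 0, fun i => h.range_succ (i + 1),
        fun i k => (h.le (i + 1) k).trans (by omega)⟩ (by omega : r + 1 < e + 1) hy'
      (by rw [hyy']; exact koszulCycle_koszul y)
    obtain ⟨u, hu⟩ := exists_koszul_eq_pi
      (z := y - ((f 0).restrictScalars K).compAlternatingMap x)
      (by rw [map_sub, ← hx, hyy', sub_self])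
    refine ⟨u, ?_⟩
    rw [koszul_comp, hu]
    ext t
    simp [h.apply_zero]

end Linear

theorem eq_iff_mod_of_periodic {V : Type} {n : ℕ} {c : ℕ → V} (hn : 0 < n)
    (hper : Function.Periodic c n) (hinj : ∀ i < n, ∀ j < n, c i = c j → i = j) (i j : ℕ) :
    c i = c j ↔ i % n = j % n := by
  rw [← hper.map_mod_nat i, ← hper.map_mod_nat j]
  exact ⟨hinj _ (Nat.mod_lt _ hn) _ (Nat.mod_lt _ hn), fun h => by rw [h]⟩

section Cycle
open MvPolynomial
variable {K : Type} [Field K] {V : Type} [Fintype V] [DecidableEq V]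

theorem coeff_sum_X_mul {a b : V} (hab : a ≠ b) (g : V → MvPolynomial V K) :
    (∑ v, X v * g v).coeff (Finsupp.single a 1 + Finsupp.single b 1) =
      (g a).coeff (Finsupp.single b 1) + (g b).coeff (Finsupp.single a 1) := by
  rw [coeff_sum, Finset.sum_eq_add a b hab]
  · rw [coeff_X_mul, add_comm (Finsupp.single a 1), coeff_X_mul]
  · intro v _ hv
    rw [coeff_X_mul', if_neg]
    simp [hv.1.symm, hv.2.symm]
  · simp
  · simp

/-- The linear form on Koszul chains given by the fundamental class of a cycle. -/
noncomputable def cycleForm {K : Type} [Field K] {V : Type} [DecidableEq V] {q : ℕ} (c : ℕ → V)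
    (z : (V → K) [⋀^Fin (q + 1)]→ₗ[K] MvPolynomial V K) :
    K :=
  ∑ j ∈ Finset.range (q + 3), (-1) ^ (q * j) *
    (z fun i => Pi.single (c (j + 2 + i)) 1).coeff
      (Finsupp.single (c j) 1 + Finsupp.single (c (j + 1)) 1)

theorem cycleForm_sub {V : Type} [DecidableEq V] {q : ℕ} (c : ℕ → V)
    (z z' : (V → K) [⋀^Fin (q + 1)]→ₗ[K] MvPolynomial V K) :
    cycleForm c (z - z') = cycleForm c z - cycleForm c z' := by
  simp [cycleForm, mul_sub]

theorem cycleForm_koszul {q : ℕ} {c : ℕ → V} (hper : Function.Periodic c (q + 3))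
    (hc : ∀ j, c j ≠ c (j + 1))
    (u : (V → K) [⋀^Fin (q + 2)]→ₗ[K] MvPolynomial V K) : cycleForm c (koszul K u) = 0 := by
  let U : ℕ → K := fun j =>
    (u fun i => Pi.single (c (j + 1 + i)) 1).coeff (Finsupp.single (c j) 1)
  have h : ∀ j, (koszul K u fun i : Fin (q + 1) => Pi.single (c (j + 2 + i)) 1).coeff
      (Finsupp.single (c j) 1 + Finsupp.single (c (j + 1)) 1) = U j - (-1) ^ q * U (j + 1) := by
    intro j
    simp only [koszul_apply, smul_eq_mul]
    rw [coeff_sum_X_mul (hc j), add_comm]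
    have h1 : (fun i : Fin (q + 2) => (Pi.single (c (j + 1 + i)) 1 : V → K)) =
        Matrix.vecCons (Pi.single (c (j + 1)) 1) fun i => Pi.single (c (j + 2 + i)) 1 := by
      ext1 i
      cases i using Fin.cases with
      | zero => simp
      | succ i => simp [add_comm, add_left_comm]
    have h2 : (fun i : Fin (q + 2) => (Pi.single (c (j + 1 + 1 + i)) 1 : V → K)) =
        (Fin.last (q + 1)).insertNth (Pi.single (c j) 1)
          fun i => Pi.single (c (j + 2 + i)) 1 := by
      ext1 i
      cases i using Fin.lastCases with
      | last =>
        have : c (j + 1 + 1 + (q + 1)) = c j := by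
          rw [← hper j]
          congr 1
          omega
        simp [this]
      | cast i => simp [add_assoc]
    simp only [U]
    rw [h1, h2, AlternatingMap.map_insertNth, coeff_smul, Fin.val_last, sub_eq_add_neg]
    congr 1
    have h3 : ((-1 : K) ^ q) * (-1) ^ q = 1 := by rw [← mul_pow]; simp
    simp only [Int.reduceNeg, pow_succ, zsmul_eq_mul, Int.cast_mul, Int.cast_pow, Int.cast_neg,
      Int.cast_one]
    linear_combination -(coeff _ _) * h3
  have h' : cycleForm c (koszul K u) = ∑ j ∈ Finset.range (q + 3),
      ((-1) ^ (q * j) * U j - (-1) ^ (q * (j + 1)) * U (j + 1)) := by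
    refine Finset.sum_congr rfl fun j _ => ?_
    rw [h]
    ring
  rw [h', Finset.sum_range_sub']
  have hU : U (q + 3) = U 0 := by
    have : ∀ j, c (q + 3 + j) = c j := fun j => by rw [add_comm]; exact hper j
    have h0 := this 0
    simp only [add_zero] at h0
    simp only [U, add_assoc (q + 3), this, h0, zero_add]
  have hev : Even (q * (q + 3)) := by
    rcases Nat.even_or_odd q with h | h
    · exact h.mul_right _
    · exact (h.add_odd (by decide)).mul_left _
  rw [hU, hev.neg_one_pow]
  simp

/-- The complement of a graph whose edge ideal has a linear resolution contains no long cycle of a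
certain type, for example no induced cycle. -/
theorem HasResolutionDegreeBound.not_cycle {G : SimpleGraph V} {q : ℕ} {c : ℕ → V}
    (hper : Function.Periodic c (q + 3))
    (hinj : ∀ i < q + 3, ∀ j < q + 3, c i = c j → i = j)
    (h : HasResolutionDegreeBound K (edgeIdeal K G) 2)
    (hcyc : ∀ j, ¬ G.Adj (c j) (c (j + 1)))
    (hadj : ∀ j, 2 ≤ j → j < q + 3 → G.Adj (c 0) (c j) ∨ G.Adj (c 1) (c j)) : False := by
  obtain ⟨m, d, f, ε, hε, hf, hrange, hf0, hfs, hd⟩ := h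
  have hres : IsLinearRes d f ε 2 := ⟨fun i k l => ⟨fun _ => (hf i k l).1, (hf i k l).2⟩, hf0,
    hfs, hd⟩
  have hmod := eq_iff_mod_of_periodic (by omega) hper hinj
  have hc : ∀ j, c j ≠ c (j + 1) := by
    intro j
    have hj := Nat.mod_lt j (by omega : q + 3 > 0)
    rw [Ne, hmod, Nat.add_mod_eq_ite, Nat.mod_eq_of_lt (by omega : 1 < q + 3)]
    split_ifs <;> omega
  let D : (V → K) [⋀^Fin (q + 1)]→ₗ[K] K := (Matrix.detRowAlternating).compLinearMap
    (LinearMap.funLeft K K fun j : Fin (q + 1) => c (j + 2))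
  let z : (V → K) [⋀^Fin (q + 1)]→ₗ[K] MvPolynomial V K :=
    (LinearMap.toSpanSingleton K _ (X (c 0) * X (c 1) : MvPolynomial V K)).compAlternatingMap D
  have hz : ∀ t, z t = D t • (X (c 0) * X (c 1)) := fun t => rfl
  have hzI : ∀ t, koszul K z t ∈ LinearMap.range ε := by
    intro t
    rw [hrange, koszul_apply]
    refine sum_mem fun v _ => ?_
    rw [hz]
    by_cases hv : ∃ j : Fin (q + 1), v = c (j + 2)
    · obtain ⟨j, rfl⟩ := hv
      rw [smul_comm]
      refine Submodule.smul_of_tower_mem _ _ ?_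
      rw [smul_eq_mul]
      rcases hadj (j + 2) (by omega) (by omega) with h | h
      · rw [← mul_assoc, mul_comm (X (c (j + 2)) : MvPolynomial V K)]
        exact Ideal.mul_mem_right _ _ (Ideal.subset_span ⟨_, _, h, rfl⟩)
      · rw [mul_left_comm, mul_comm (X (c (j + 2)) : MvPolynomial V K)]
        exact Ideal.mul_mem_left _ _ (Ideal.subset_span ⟨_, _, h, rfl⟩)
    · have : D (Matrix.vecCons (Pi.single v 1) t) = 0 := by
        refine Matrix.detRowAlternating.map_coord_zero (0 : Fin (q + 1)) ?_
        ext j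
        have : c (j + 2) ≠ v := fun h => hv ⟨j, h.symm⟩
        simp [this]
      rw [this]
      simp
  have hz3 : ∀ t, (koszul K z t).IsHomogeneous 3 := by
    intro t
    rw [koszul_apply]
    refine IsHomogeneous.sum _ _ _ fun v _ => ?_
    rw [hz, smul_comm, smul_eq_C_mul]
    exact (isHomogeneous_C V _).mul
      ((isHomogeneous_X K v).mul ((isHomogeneous_X K _).mul (isHomogeneous_X K _)))
  obtain ⟨y, hy, hyz⟩ := exists_alternating_lift (d := d 0) (e := 3) (φ := ε)
    (P := homogeneousComponent 3) (y := koszul K z) (fun e' x hx => by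
      have : (ε x).IsHomogeneous e' := map_mem_of_map_single (𝒩 := homGr K V)
        gradedSMulFamily_self hε hx
      rw [homogeneousComponent_of_mem this]
      exact if_congr eq_comm rfl rfl) hzI
    (fun t => (homogeneousComponent_of_mem (hz3 t)).trans (if_pos rfl))
  obtain ⟨x, hx⟩ := hres.exists_koszul_eq (by omega : 2 < 3) hy
    (by rw [hyz]; exact koszulCycle_koszul z)
  obtain ⟨u, hu⟩ := exists_koszul_eq (z := z - (ε.restrictScalars K).compAlternatingMap x)
    (by rw [map_sub, ← hx, hyz, sub_self])
  have h0 := cycleForm_koszul hper hc u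
  rw [hu, cycleForm_sub] at h0
  have h1 : cycleForm c ((ε.restrictScalars K).compAlternatingMap x) = 0 := by
    refine Finset.sum_eq_zero fun j _ => mul_eq_zero_of_right _ ?_
    by_contra hne
    obtain ⟨a, b, hab, hle⟩ := exists_adj_of_mem_edgeIdeal
      (hrange.le (LinearMap.mem_range_self ε _)) _ hne
    have key := eq_of_le_of_degree_eq hle (by simp)
    rw [Finsupp.single_add_single_eq_single_add_single one_ne_zero one_ne_zero] at key
    rcases key with ⟨rfl, rfl⟩ | ⟨-, rfl, rfl⟩ | ⟨h, -⟩
    · exact hcyc j hab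
    · exact hcyc j hab.symm
    · simp at h
  have h2 : cycleForm c z = 1 := by
    have hX : (X (c 0) * X (c 1) : MvPolynomial V K) =
        monomial (Finsupp.single (c 0) 1 + Finsupp.single (c 1) 1) 1 := by
      simp [X, monomial_mul]
    rw [cycleForm, Finset.sum_eq_single 0]
    · have hD : D (fun i => Pi.single (c (0 + 2 + i)) 1) = 1 := by
        have : (fun i : Fin (q + 1) => LinearMap.funLeft K K (fun j : Fin (q + 1) => c (j + 2))
            (Pi.single (c (0 + 2 + i)) 1)) = (1 : Matrix (Fin (q + 1)) (Fin (q + 1)) K) := by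
          ext i j
          have : c (j + 2) = c (0 + 2 + i) ↔ i = j := by
            rw [hmod, Nat.mod_eq_of_lt (by omega),
              Nat.mod_eq_of_lt (by omega), Fin.ext_iff]
            omega
          simp [Pi.single_apply, Matrix.one_apply, this]
        exact (congrArg Matrix.det this).trans Matrix.det_one
      rw [hz, hD, hX]
      simp
    · intro j hj hj0
      have hj := Finset.mem_range.1 hj
      rw [hz, hX, coeff_smul, coeff_monomial, if_neg]
      · simp
      · intro key
        rw [Finsupp.single_add_single_eq_single_add_single one_ne_zero one_ne_zero] at key
        rcases key with ⟨h, -⟩ | ⟨-, h, h'⟩ | ⟨h, -⟩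
        · exact hj0 (hinj 0 (by omega) j hj h).symm
        · rw [← hinj 1 (by omega) j hj h', hmod, Nat.mod_eq_of_lt (by omega),
            Nat.mod_eq_of_lt (by omega)] at h
          omega
        · simp at h
    · simp
  rw [h1, h2, sub_zero] at h0
  exact one_ne_zero h0

end Cycle

section Chordal
variable {V : Type} {G : SimpleGraph V}

theorem HasResolutionDegreeBound.not_adj_of_walk {K : Type} [Field K] [Finite V]
    (h : HasResolutionDegreeBound K (edgeIdeal K G) 2) {v s t : V} (hvs : ¬ G.Adj v s)
    (hvt : ¬ G.Adj v t) (hs : v ≠ s) (ht : v ≠ t) (p : Gᶜ.Walk t s)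
    (hp : ∀ x ∈ p.support, x = s ∨ x = t ∨ G.Adj v x) : ¬ G.Adj s t := by
  classical
  have := Fintype.ofFinite V
  intro hst
  wlog hpath : p.IsPath generalizing p
  · exact this p.bypass (fun x hx => hp x (p.support_bypass_subset_support hx)) p.bypass_isPath
  have hv : v ∉ p.support := fun hv => by
    rcases hp v hv with h | h | h
    exacts [hs h, ht h, G.irrefl h]
  have hlen : 0 < p.length := by
    by_contra hl
    exact hst.ne (p.eq_of_length_eq_zero (by omega)).symm
  obtain ⟨q, hq⟩ := Nat.exists_eq_succ_of_ne_zero hlen.ne'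
  have hq : p.length = q + 1 := hq
  obtain ⟨c', h0, h1, h2⟩ : ∃ c' : ℕ → V, c' 0 = s ∧ c' 1 = v ∧ ∀ i, c' (i + 2) = p.getVert i :=
    ⟨fun | 0 => s | 1 => v | i + 2 => p.getVert i, rfl, rfl, fun _ => rfl⟩
  have hpq : p.getVert (q + 1) = s := by rw [← hq, p.getVert_length]
  have hmod : ∀ i < q + 3, i % (q + 3) = i := fun i hi => Nat.mod_eq_of_lt hi
  refine h.not_cycle (c := fun i => c' (i % (q + 3))) (q := q) ?_ ?_ ?_ ?_
  · intro i
    simp only [Nat.add_mod_right]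
  · intro i hi j hj hij
    simp only [hmod i hi, hmod j hj] at hij
    have hinj : ∀ {a b}, a ≤ q + 1 → b ≤ q + 1 → p.getVert a = p.getVert b → a = b :=
      fun {a b} ha hb hab => hpath.getVert_injOn (by simpa [hq] using ha) (by simpa [hq] using hb)
        hab
    have hget : ∀ a, p.getVert a ≠ v := fun a h => hv (h ▸ p.getVert_mem_support a)
    match i, j with
    | 0, 0 => rfl
    | 0, 1 => exact (hs (h1.symm.trans (hij.symm.trans h0))).elim
    | 0, j + 2 =>
      have := hinj le_rfl (by omega) (hpq.trans (h0.symm.trans (hij.trans (h2 j))))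
      omega
    | 1, 0 => exact (hs (h1.symm.trans (hij.trans h0))).elim
    | 1, 1 => rfl
    | 1, j + 2 => exact (hget j ((h2 j).symm.trans (hij.symm.trans h1))).elim
    | i + 2, 0 =>
      have := hinj le_rfl (by omega) (hpq.trans (h0.symm.trans (hij.symm.trans (h2 i))))
      omega
    | i + 2, 1 => exact (hget i ((h2 i).symm.trans (hij.trans h1))).elim
    | i + 2, j + 2 =>
      exact congrArg (· + 2) (hinj (by omega) (by omega) ((h2 i).symm.trans (hij.trans (h2 j))))
  · intro j
    obtain ⟨i, hi, hij⟩ : ∃ i, i < q + 3 ∧ j % (q + 3) = i :=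
      ⟨_, Nat.mod_lt _ (by omega), rfl⟩
    rw [Nat.add_mod_eq_ite, hij, hmod 1 (by omega)]
    match i with
    | 0 =>
      rw [if_neg (by omega), h0, zero_add, h1]
      exact fun h => hvs h.symm
    | 1 =>
      rw [if_neg (by omega), h1, h2, p.getVert_zero]
      exact hvt
    | i + 2 =>
      have hadj := p.adj_getVert_succ (i := i) (by omega)
      have : c' (if q + 3 ≤ i + 2 + 1 then i + 2 + 1 - (q + 3) else i + 2 + 1) =
          p.getVert (i + 1) := by
        split_ifs with hle
        · rw [show i = q by omega, hpq, show q + 2 + 1 - (q + 3) = 0 by omega, h0]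
        · exact h2 _
      rw [this, h2]
      exact ((SimpleGraph.compl_adj ..).1 hadj).2
  · intro j hj hjq
    obtain ⟨i, rfl⟩ := Nat.exists_eq_add_of_le' hj
    simp only [hmod _ hjq, hmod 0 (by omega), hmod 1 (by omega)]
    rw [h2, h0, h1]
    rcases hp _ (p.getVert_mem_support i) with h | h | h
    · have := hpath.getVert_injOn (by simp; omega : i ∈ {i | i ≤ p.length})
        (by simp [hq] : q + 1 ∈ {i | i ≤ p.length}) (h.trans hpq.symm)
      omega
    · exact Or.inl (h.symm ▸ hst)
    · exact Or.inr h

/-- A form of Dirac's theorem: if all minimal vertex separators of induced subgraphs of the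
complement of `G` are cliques, then every vertex has a simplicial non-neighbour in the complement,
unless it is a neighbour of all other vertices. -/
theorem exists_simplicial
    (hG : ∀ {v s t : V}, ¬ G.Adj v s → ¬ G.Adj v t → v ≠ s → v ≠ t → ∀ p : Gᶜ.Walk t s,
      (∀ x ∈ p.support, x = s ∨ x = t ∨ G.Adj v x) → ¬ G.Adj s t)
    {A : Set V} (hA : A.Finite) {v x : V} (hv : v ∈ A) (hx : x ∈ A) (hvx : G.Adj v x) :
    ∃ u ∈ A, G.Adj v u ∧ ∀ a ∈ A, ∀ b ∈ A, ¬ G.Adj u a → ¬ G.Adj u b → ¬ G.Adj a b := by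
  induction hn : A.ncard using Nat.strong_induction_on generalizing A v x with
  | _ n ih =>
    subst hn
    let R : Set V := {y | y ∈ A ∧ G.Adj v y}
    let D : Set V := {y | ∃ p : Gᶜ.Walk x y, ∀ z ∈ p.support, z ∈ R}
    let S : Set V := {s | s ∈ A ∧ ¬ G.Adj v s ∧ ∃ d ∈ D, ¬ G.Adj s d}
    have hDR : D ⊆ R := fun y ⟨p, hp⟩ => hp y p.end_mem_support
    have hxD : x ∈ D := ⟨.nil, by simpa using ⟨hx, hvx⟩⟩
    have hBA : D ∪ S ⊂ A := by
      refine ⟨Set.union_subset (fun y hy => (hDR hy).1) fun y hy => hy.1, fun h => ?_⟩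
      rcases h hv with h | ⟨-, -, d, hd, h⟩
      · exact G.irrefl (hDR h).2
      · exact h (hDR hd).2
    have hclosed : ∀ d ∈ D, ∀ a ∈ A, ¬ G.Adj d a → a ∈ D ∪ S := by
      rintro d ⟨p, hp⟩ a ha hda
      by_cases hva : G.Adj v a
      · left
        rcases eq_or_ne d a with rfl | hne
        · exact ⟨p, hp⟩
        · refine ⟨p.concat ((SimpleGraph.compl_adj ..).2 ⟨hne, hda⟩), fun z hz => ?_⟩
          rw [SimpleGraph.Walk.support_concat, List.mem_append,
            List.mem_singleton] at hz
          rcases hz with hz | rfl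
          exacts [hp z hz, ⟨ha, hva⟩]
      · exact Or.inr ⟨ha, hva, d, ⟨p, hp⟩, fun h => hda h.symm⟩
    have hS : ∀ s ∈ S, ∀ t ∈ S, ¬ G.Adj s t := by
      rintro s ⟨-, hs, a, ⟨p, hp⟩, hsa⟩ t ⟨-, ht, b, ⟨p', hp'⟩, htb⟩
      have hva := hp a p.end_mem_support
      have hvb := hp' b p'.end_mem_support
      refine hG hs ht (fun h => hsa (h ▸ hva.2)) (fun h => htb (h ▸ hvb.2))
        (.cons ((SimpleGraph.compl_adj ..).2 ⟨fun h => ht (h ▸ hvb.2), htb⟩)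
          ((p'.reverse.append p).concat
            ((SimpleGraph.compl_adj ..).2 ⟨fun h => hs (h ▸ hva.2), fun h => hsa h.symm⟩))) ?_
      intro z hz
      simp only [SimpleGraph.Walk.support_cons, SimpleGraph.Walk.support_concat,
        List.mem_cons, List.mem_append, SimpleGraph.Walk.mem_support_append_iff,
        SimpleGraph.Walk.support_reverse, List.mem_reverse, List.not_mem_nil, or_false] at hz
      rcases hz with rfl | (hz | hz) | rfl
      exacts [Or.inr (Or.inl rfl), Or.inr (Or.inr (hp' z hz).2), Or.inr (Or.inr (hp z hz).2),
        Or.inl rfl]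
    by_cases hB : ∀ a ∈ D ∪ S, ∀ b ∈ D ∪ S, ¬ G.Adj a b
    · exact ⟨x, hx, hvx, fun a ha b hb hxa hxb =>
        hB a (hclosed x hxD a ha hxa) b (hclosed x hxD b hb hxb)⟩
    · obtain ⟨a, ha, b, hb, hab, haS⟩ : ∃ a ∈ D ∪ S, ∃ b ∈ D ∪ S, G.Adj a b ∧
          (a ∈ S ∨ ∀ s ∈ S, ∀ y ∈ D ∪ S, ¬ G.Adj s y) := by
        by_cases h : ∀ s ∈ S, ∀ y ∈ D ∪ S, ¬ G.Adj s y
        · push Not at hB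
          obtain ⟨a, ha, b, hb, hab⟩ := hB
          exact ⟨a, ha, b, hb, hab, Or.inr h⟩
        · push Not at h
          obtain ⟨a, ha, b, hb, hab⟩ := h
          exact ⟨a, Or.inr ha, b, hb, hab, Or.inl ha⟩
      obtain ⟨u, hu, hau, hsimp⟩ := ih _ (Set.ncard_lt_ncard hBA hA) (hA.subset hBA.1) ha hb hab rfl
      have huD : u ∈ D := hu.resolve_right fun huS => haS.elim (fun h => hS a h u huS hau)
        fun h => h u huS a ha hau.symm
      exact ⟨u, (hDR huD).1, (hDR huD).2, fun a ha b hb hua hub =>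
        hsimp a (hclosed u huD a ha hua) b (hclosed u huD b hb hub) hua hub⟩

/-- Fröberg's theorem, in terms of repeatedly splitting at a vertex. -/
theorem HasResolutionDegreeBound.splitBound {K : Type} [Field K] [Finite V]
    (h : HasResolutionDegreeBound K (edgeIdeal K G) 2) (A : Set V) : SplitBound G A 2 := by
  induction hn : A.ncard using Nat.strong_induction_on generalizing A with
  | _ n ih =>
    subst hn
    by_cases hA : ∀ u ∈ A, ∀ v ∈ A, ¬ G.Adj u v
    · exact .edgeless hA
    · push Not at hA
      obtain ⟨v, hv, x, hx, hvx⟩ := hA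
      obtain ⟨u, hu, -, hsimp⟩ := exists_simplicial h.not_adj_of_walk A.toFinite hv hx hvx
      have hss : A \ {u} ⊂ A := ⟨Set.sdiff_subset, fun h => (h hu).2 rfl⟩
      refine .split hu (ih _ (Set.ncard_lt_ncard hss) _ rfl)
        (.edgeless fun a ha b hb => ?_)
      exact hsimp a ha.1 b hb.1 (fun h => ha.2 (Or.inr h)) fun h => hb.2 (Or.inr h)

end Chordal

section Main
variable {V : Type} {G : SimpleGraph V}

theorem SplitBound.image {W : Type} {H : SimpleGraph W} (φ : H ↪g G) {A : Set W} {r : ℕ}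
    (h : SplitBound H A r) : SplitBound G (φ '' A) r := by
  induction h with
  | edgeless h =>
    refine .edgeless ?_
    rintro _ ⟨u, hu, rfl⟩ _ ⟨v, hv, rfl⟩
    rw [φ.map_adj_iff]
    exact h u hu v hv
  | @split A w r hw _ _ ih1 ih2 =>
    refine .split (Set.mem_image_of_mem φ hw) ?_ ?_
    · rwa [Set.image_sdiff φ.injective, Set.image_singleton] at ih1
    · convert ih2 using 1
      rw [Set.image_sdiff φ.injective]
      ext x
      constructor
      · rintro ⟨⟨a, ha, rfl⟩, hx⟩
        refine ⟨⟨a, ha, rfl⟩, ?_⟩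
        rintro ⟨b, rfl | hb, h⟩
        · exact hx (Or.inl h.symm)
        · exact hx (Or.inr (h ▸ φ.map_adj_iff.2 hb))
      · rintro ⟨⟨a, ha, rfl⟩, hx⟩
        refine ⟨⟨a, ha, rfl⟩, ?_⟩
        rintro (h | h)
        · exact hx ⟨w, Or.inl rfl, h.symm⟩
        · exact hx ⟨a, Or.inr (φ.map_adj_iff.1 h), rfl⟩

theorem SplitBound.of_induce {B : Set V} {r : ℕ} (h : SplitBound (G.induce B) Set.univ r) :
    SplitBound G B r := by
  have := h.image (SimpleGraph.Embedding.induce B)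
  rwa [Set.image_univ, show Set.range (SimpleGraph.Embedding.induce (G := G) B) = B from
    Subtype.range_coe] at this

variable {K : Type} [Field K]

theorem edgeIdeal_eq_bot (h : ∀ u v, ¬ G.Adj u v) : edgeIdeal K G = ⊥ := by
  rw [edgeIdeal, Ideal.span_eq_bot]
  rintro _ ⟨u, v, huv, -⟩
  exact (h u v huv).elim

theorem hasResolutionDegreeBound_bot (r : ℕ) :
    HasResolutionDegreeBound K (⊥ : Ideal (MvPolynomial V K)) r := by
  refine ⟨fun _ => 0, fun _ k => k.elim0, fun _ => 0, 0, fun k => k.elim0, fun _ k => k.elim0,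
    LinearMap.range_zero, ?_, fun _ => ?_, fun _ k => k.elim0⟩
  all_goals exact Subsingleton.elim _ _

theorem HasResolutionDegreeBound.not_adj (h : HasResolutionDegreeBound K (edgeIdeal K G) 1)
    (u v : V) : ¬ G.Adj u v := by
  obtain ⟨m, d, f, ε, hε, -, hrange, -, -, hd⟩ := h
  have h0 : ε = 0 := by
    refine LinearMap.pi_ext' fun k => LinearMap.ext_ring ?_
    ext b
    by_contra hb
    obtain ⟨u, v, -, hle⟩ := exists_adj_of_mem_edgeIdeal
      (hrange.le (LinearMap.mem_range_self ε (Pi.single k 1))) b hb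
    have h1 := isHomogeneous_iff_coeff.1 (hε k) b hb
    have h2 := hd 0 k
    have h3 := Finsupp.degree_mono hle
    simp at h3
    omega
  intro huv
  rw [h0, LinearMap.range_zero] at hrange
  have : (MvPolynomial.X u * MvPolynomial.X v : MvPolynomial V K) ∈ edgeIdeal K G :=
    Ideal.subset_span ⟨u, v, huv, rfl⟩
  rw [← hrange] at this
  simp [MvPolynomial.X_ne_zero] at this

theorem hasResolutionDegreeBound_of_reg_le [Finite V] {r : ℕ} (h : reg K (edgeIdeal K G) ≤ r) :
    HasResolutionDegreeBound K (edgeIdeal K G) r := by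
  obtain ⟨r', hr'⟩ := splitBound_of_finite (G := G) (Set.toFinite Set.univ)
  have := hr'.hasResolutionDegreeBound (K := K) 1
  rw [pow_one] at this
  exact (Nat.sInf_mem (⟨_, this⟩ : {r | HasResolutionDegreeBound K (edgeIdeal K G)
    r}.Nonempty)).mono h

theorem splitBound_max (f : (V : Type) → [Finite V] → SimpleGraph V → ℕ)
    (h1 : ∀ (V : Type) [Finite V] (G : SimpleGraph V), reg K (edgeIdeal K G) ≤ f V G)
    (h2 : ∀ (V : Type) [Finite V] (G : SimpleGraph V), G.edgeSet.Nonempty →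
      ∃ w : V, f _ (G.induce ({w}ᶜ : Set V)) ≤ f V G ∧
        f _ (delClosedNbhd G w) ≤ max (f V G - 1) 2)
    (V : Type) [Finite V] (G : SimpleGraph V) : SplitBound G Set.univ (max (f V G) 2) := by
  induction hn : Nat.card V using Nat.strong_induction_on generalizing V with
  | _ n ih =>
    subst hn
    rcases le_or_gt (f V G) 2 with hf | hf
    · rw [max_eq_right hf]
      exact (hasResolutionDegreeBound_of_reg_le ((h1 V G).trans hf)).splitBound Set.univ
    · rcases G.edgeSet.eq_empty_or_nonempty with hG | hG
      · rw [SimpleGraph.edgeSet_eq_empty] at hG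
        subst hG
        exact SplitBound.mono (r := 1) (.edgeless fun u _ v _ h => h) (by omega)
      · obtain ⟨w, hw1, hw2⟩ := h2 V G hG
        obtain ⟨r, hr⟩ := Nat.exists_eq_add_of_le' hf.le
        have hw : ∀ B : Set V, w ∉ B → Nat.card B < Nat.card V := fun B hB =>
          Finite.card_subtype_lt hB
        have k1 := (ih _ (hw {w}ᶜ (by simp)) _ (G.induce {w}ᶜ) rfl).of_induce
        have k2 := (ih _ (hw (closedNbhd G w)ᶜ (by simp [closedNbhd])) _
          (delClosedNbhd G w) rfl).of_induce
        have k1 := k1.mono (by omega : _ ≤ r + 2)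
        have k2 := k2.mono (by omega : _ ≤ r + 1)
        rw [Set.compl_eq_univ_sdiff] at k1 k2
        rw [max_eq_left hf.le, hr]
        exact .split (Set.mem_univ w) k1 k2

end Main

/-- The inductive machinery of Banerjee–Beyarslan–Hà: if `f` is a function from finite
simple graphs to `ℕ` such that (1) `reg(I(G)) ≤ f(G)` for every graph `G`, and (2) for
every graph `G` with at least one edge there is a vertex `w` with `f(G - w) ≤ f(G)` and
`f(G - N_G[w]) ≤ max (f(G) - 1) 2`, then `reg(I(G)^s) ≤ 2s + f(G) - 2` for every graph
`G` and every `s ≥ 1`. -/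
theorem stmt17 (K : Type) [Field K]
    (f : (V : Type) → [Finite V] → SimpleGraph V → ℕ)
    (h1 : ∀ (V : Type) [Finite V] (G : SimpleGraph V), reg K (edgeIdeal K G) ≤ f V G)
    (h2 : ∀ (V : Type) [Finite V] (G : SimpleGraph V), G.edgeSet.Nonempty →
      ∃ w : V, f _ (G.induce ({w}ᶜ : Set V)) ≤ f V G ∧
        f _ (delClosedNbhd G w) ≤ max (f V G - 1) 2)
    (V : Type) [Finite V] (G : SimpleGraph V) (s : ℕ) (hs : 1 ≤ s) :
    reg K ((edgeIdeal K G) ^ s) ≤ 2 * s + f V G - 2 := by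
  refine Nat.sInf_le ?_
  rcases le_or_gt 2 (f V G) with hf | hf
  · have := (splitBound_max f h1 h2 V G).hasResolutionDegreeBound (K := K) s
    rwa [max_eq_left hf] at this
  · have := hasResolutionDegreeBound_of_reg_le ((h1 V G).trans (by omega : f V G ≤ 1))
    rw [edgeIdeal_eq_bot this.not_adj, ← Ideal.zero_eq_bot, zero_pow (by omega)]
    exact hasResolutionDegreeBound_bot _

end Paper
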